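/- Assume the commutation hypothesis: 𝓕^{τ'}_{u,v} ∘ 𝓖^{τ''}_ω = 𝓖^{τ''}_ω ∘ 𝓕^{τ'}_{u,v} for all u ∈ P, v ∈ Q, ω ∈ Ω and all τ', τ'' ≥ 0. Define W₀ = W₀* = [0,ϑ] × ℝⁿ, W_k = A(W_{k−1}) and W_k* = A*(W*_{k−1}) for k ∈ ℕ. Then ⋂_{k≥0} W_k = ⋂_{k≥0} W_k*; that is, the solvability sets of the original M-approach game and of the transformed M*-approach game (given by Chentsov's Programmed Iteration representation 𝔚 = ⋂_{k≥0} W_k) coincide. -/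

import Mathlib

open MeasureTheory

noncomputable section

/-- A slide control on `[0,ϑ] × Λ`: a Borel measure on `ℝ × C` carried by `[0,ϑ] × Λ`
whose marginal on the time axis is Lebesgue measure on `[0,ϑ]`. -/
def IsSlideControl {C : Type*} [MeasurableSpace C] (ϑ : ℝ) (Λ : Set C)
    (μ : Measure (ℝ × C)) : Prop :=
  μ.map Prod.fst = volume.restrict (Set.Icc 0 ϑ) ∧ μ ((Set.Icc 0 ϑ ×ˢ Λ)ᶜ) = 0

/-- A motion of `ẋ = h(x,b)` generated by the slide control `μ` from the position
`(t₀, x₀)`. -/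
def IsMotion {C : Type*} {n : ℕ} [MeasurableSpace C] (ϑ : ℝ) (Λ : Set C)
    (h : EuclideanSpace ℝ (Fin n) → C → EuclideanSpace ℝ (Fin n))
    (μ : Measure (ℝ × C)) (t₀ : ℝ) (x₀ : EuclideanSpace ℝ (Fin n))
    (x : ℝ → EuclideanSpace ℝ (Fin n)) : Prop :=
  ContinuousOn x (Set.Icc 0 ϑ) ∧ x t₀ = x₀ ∧
  (∀ t ∈ Set.Icc 0 ϑ, t₀ ≤ t →
    x t = x₀ + ∫ z in Set.Icc t₀ t ×ˢ Λ, h (x z.1) z.2 ∂μ) ∧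
  (∀ t ∈ Set.Icc 0 ϑ, t ≤ t₀ →
    x t = x₀ - ∫ z in Set.Icc t t₀ ×ˢ Λ, h (x z.1) z.2 ∂μ)

/-- `E` decreases by sections relative to the control system `ẋ = g(x,ω)`, `ω ∈ Ω`. -/
def DecreasesBySections {n m : ℕ} (ϑ : ℝ) (Ω : Set (EuclideanSpace ℝ (Fin m)))
    (g : EuclideanSpace ℝ (Fin n) → EuclideanSpace ℝ (Fin m) → EuclideanSpace ℝ (Fin n))
    (E : Set (ℝ × EuclideanSpace ℝ (Fin n))) : Prop :=
  ∀ tstar xstar, (tstar, xstar) ∈ E → ∀ t ∈ Set.Icc 0 tstar,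
    ∀ σ : Measure (ℝ × EuclideanSpace ℝ (Fin m)), IsSlideControl ϑ Ω σ →
      ∀ y : ℝ → EuclideanSpace ℝ (Fin n), IsMotion ϑ Ω g σ tstar xstar y → (t, y t) ∈ E

/-- The program absorption operator `A*` of the transformed game `ẋ = f*(x,(ν,u,ω),v)`,
`(ν,u,ω) ∈ P* = {0,1} × P × Ω`, with target set `{ϑ} × F`. -/
def progAbsorbStar {n p q m : ℕ} (ϑ : ℝ)
    (P : Set (EuclideanSpace ℝ (Fin p))) (Q : Set (EuclideanSpace ℝ (Fin q)))
    (Ω : Set (EuclideanSpace ℝ (Fin m)))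
    (f : EuclideanSpace ℝ (Fin n) → EuclideanSpace ℝ (Fin p) → EuclideanSpace ℝ (Fin q) →
      EuclideanSpace ℝ (Fin n))
    (g : EuclideanSpace ℝ (Fin n) → EuclideanSpace ℝ (Fin m) → EuclideanSpace ℝ (Fin n))
    (F : Set (EuclideanSpace ℝ (Fin n))) (E : Set (ℝ × EuclideanSpace ℝ (Fin n))) :
    Set (ℝ × EuclideanSpace ℝ (Fin n)) :=
  {pt ∈ E | ∀ v ∈ Q,
    ∃ μ : Measure (ℝ × (ℝ × EuclideanSpace ℝ (Fin p) × EuclideanSpace ℝ (Fin m))),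
      IsSlideControl ϑ (({0, 1} : Set ℝ) ×ˢ P ×ˢ Ω) μ ∧
      ∃ y : ℝ → EuclideanSpace ℝ (Fin n),
        IsMotion ϑ (({0, 1} : Set ℝ) ×ˢ P ×ˢ Ω)
          (fun x ustar => ustar.1 • f x ustar.2.1 v + (1 - ustar.1) • g x ustar.2.2)
          μ pt.1 pt.2 y ∧
        y ϑ ∈ F ∧ ∀ t ∈ Set.Icc pt.1 ϑ, (t, y t) ∈ E}

/-- The program absorption operator `A` of the original game `ẋ = f(x,u,v)` with target
set `M`. -/
def progAbsorb {n p q : ℕ} (ϑ : ℝ)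
    (P : Set (EuclideanSpace ℝ (Fin p))) (Q : Set (EuclideanSpace ℝ (Fin q)))
    (f : EuclideanSpace ℝ (Fin n) → EuclideanSpace ℝ (Fin p) → EuclideanSpace ℝ (Fin q) →
      EuclideanSpace ℝ (Fin n))
    (M E : Set (ℝ × EuclideanSpace ℝ (Fin n))) : Set (ℝ × EuclideanSpace ℝ (Fin n)) :=
  {pt ∈ E | ∀ v ∈ Q, ∃ μ : Measure (ℝ × EuclideanSpace ℝ (Fin p)),
    IsSlideControl ϑ P μ ∧ ∃ ξ ∈ Set.Icc pt.1 ϑ, ∃ y : ℝ → EuclideanSpace ℝ (Fin n),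
      IsMotion ϑ P (fun x u => f x u v) μ pt.1 pt.2 y ∧ (ξ, y ξ) ∈ M ∧
      ∀ t ∈ Set.Icc pt.1 ξ, (t, y t) ∈ E}

namespace Slide
set_option linter.unusedSectionVars false
open Set Filter Topology

variable {E : Type*} [NormedAddCommGroup E] [NormedSpace ℝ E] [ProperSpace E]
variable {C : Type*} [TopologicalSpace C] [MeasurableSpace C] [BorelSpace C]
  [SecondCountableTopology C]

/-- sub-Lebesgue controls -/
def Ctl (Λ : Set C) (μ : Measure (ℝ × C)) : Prop :=
  μ.map Prod.fst ≤ volume ∧ ∀ᵐ z ∂μ, z.2 ∈ Λ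

/-- the vertical strip over `(s,t]` -/
def strip (C : Type*) (s t : ℝ) : Set (ℝ × C) := Prod.fst ⁻¹' Ioc s t

/-- motions in increment form -/
structure Mot (h : E → C → E) (μ : Measure (ℝ × C)) (a b : ℝ) (x : ℝ → E) : Prop where
  cont : Continuous x
  inc : ∀ s t, a ≤ s → s ≤ t → t ≤ b → x t - x s = ∫ z in strip C s t, h (x z.1) z.2 ∂μ

/-- admissible right-hand sides -/
structure Good (Λ : Set C) (h : E → C → E) : Prop where
  mset : MeasurableSet Λ
  cont : Continuous fun z : E × C => h z.1 z.2
  lip : ∀ R : ℝ, ∃ L : ℝ, 0 ≤ L ∧ ∀ b ∈ Λ, ∀ x y, ‖x‖ ≤ R → ‖y‖ ≤ R →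
    ‖h x b - h y b‖ ≤ L * ‖x - y‖
  grow : ∃ c : ℝ, 0 ≤ c ∧ ∀ b ∈ Λ, ∀ x, ‖h x b‖ ≤ c * (1 + ‖x‖)

theorem measurableSet_strip (s t : ℝ) : MeasurableSet (strip C s t) :=
  measurable_fst measurableSet_Ioc

variable {Λ : Set C} {μ : Measure (ℝ × C)} {h : E → C → E}

theorem Ctl.strip_le (hμ : Ctl Λ μ) (s t : ℝ) : μ (strip C s t) ≤ ENNReal.ofReal (t - s) := by
  rw [strip, ← Measure.map_apply measurable_fst measurableSet_Ioc, ← Real.volume_Ioc]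
  exact hμ.1 _

theorem Ctl.strip_lt (hμ : Ctl Λ μ) (s t : ℝ) : μ (strip C s t) < ⊤ :=
  (hμ.strip_le s t).trans_lt ENNReal.ofReal_lt_top

theorem Ctl.real_le (hμ : Ctl Λ μ) {s t : ℝ} (hst : s ≤ t) : μ.real (strip C s t) ≤ t - s := by
  have := ENNReal.toReal_mono ENNReal.ofReal_ne_top (hμ.strip_le s t)
  rwa [ENNReal.toReal_ofReal (by linarith)] at this

theorem Ctl.ae_restrict (hμ : Ctl Λ μ) (s t : ℝ) :
    ∀ᵐ z ∂(μ.restrict (strip C s t)), z.1 ∈ Ioc s t ∧ z.2 ∈ Λ := by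
  filter_upwards [ae_restrict_mem (measurableSet_strip (C := C) s t), ae_restrict_of_ae hμ.2]
    with z h1 h2 using ⟨h1, h2⟩

/-- integral bound by a function of time -/
theorem Ctl.norm_int_le (hμ : Ctl Λ μ) {s t : ℝ} (hst : s ≤ t) {G : ℝ × C → E} {u : ℝ → ℝ}
    (hu : Continuous u) (hu0 : ∀ r, 0 ≤ u r)
    (hG : ∀ z : ℝ × C, z.1 ∈ Ioc s t → z.2 ∈ Λ → ‖G z‖ ≤ u z.1) :
    ‖∫ z in strip C s t, G z ∂μ‖ ≤ ∫ r in s..t, u r := by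
  have hle : (μ.map Prod.fst).restrict (Ioc s t) ≤ volume.restrict (Ioc s t) :=
    Measure.restrict_mono subset_rfl hμ.1
  have hIntg : Integrable u (volume.restrict (Ioc s t)) := (hu.integrableOn_Ioc)
  have hmap : Measure.map Prod.fst (μ.restrict (strip C s t)) =
      (μ.map Prod.fst).restrict (Ioc s t) :=
    (Measure.restrict_map measurable_fst measurableSet_Ioc).symm
  have hIntg2 : Integrable (fun z : ℝ × C => u z.1) (μ.restrict (strip C s t)) := by
    have : Integrable u (Measure.map Prod.fst (μ.restrict (strip C s t))) := by
      rw [hmap]; exact hIntg.mono_measure hle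
    exact this.comp_measurable measurable_fst
  calc ‖∫ z in strip C s t, G z ∂μ‖ ≤ ∫ z in strip C s t, u z.1 ∂μ := by
        apply norm_integral_le_of_norm_le hIntg2
        filter_upwards [hμ.ae_restrict s t] with z hz using hG z hz.1 hz.2
    _ = ∫ r in Ioc s t, u r ∂(μ.map Prod.fst) := by
        rw [← hmap, integral_map measurable_fst.aemeasurable hu.aestronglyMeasurable]
    _ ≤ ∫ r in Ioc s t, u r := 
        integral_mono_measure hle (Eventually.of_forall hu0) hIntg
    _ = ∫ r in s..t, u r := (intervalIntegral.integral_of_le hst).symm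

theorem Ctl.norm_int_le_const (hμ : Ctl Λ μ) {s t : ℝ} (hst : s ≤ t) {G : ℝ × C → E} {B : ℝ}
    (hB : 0 ≤ B)
    (hG : ∀ z : ℝ × C, z.1 ∈ Ioc s t → z.2 ∈ Λ → ‖G z‖ ≤ B) :
    ‖∫ z in strip C s t, G z ∂μ‖ ≤ B * (t - s) := by
  have := hμ.norm_int_le hst (u := fun _ => B) continuous_const (fun _ => hB) hG
  simpa [mul_comm] using this

/-- boundedness of a continuous function on a compact interval -/
theorem exists_bound {x : ℝ → E} (hx : Continuous x) (a b : ℝ) :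
    ∃ R : ℝ, 0 ≤ R ∧ ∀ t ∈ Icc a b, ‖x t‖ ≤ R := by
  obtain ⟨R, hR⟩ := isCompact_Icc.exists_bound_of_continuousOn (s := Icc a b) hx.continuousOn
  exact ⟨max R 0, le_max_right _ _, fun t ht => (hR t ht).trans (le_max_left _ _)⟩

theorem Good.meas (hh : Good Λ h) {x : ℝ → E} (hx : Continuous x) (ν : Measure (ℝ × C)) :
    AEStronglyMeasurable (fun z : ℝ × C => h (x z.1) z.2) ν := by
  have : Continuous (fun z : ℝ × C => h (x z.1) z.2) :=
    hh.cont.comp ((hx.comp continuous_fst).prodMk continuous_snd)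
  exact this.aestronglyMeasurable

theorem Good.integrableOn (hh : Good Λ h) (hμ : Ctl Λ μ) {x : ℝ → E} (hx : Continuous x)
    (s t : ℝ) : IntegrableOn (fun z : ℝ × C => h (x z.1) z.2) (strip C s t) μ := by
  obtain ⟨c, hc, hg⟩ := hh.grow
  obtain ⟨R, hR0, hR⟩ := exists_bound hx s t
  refine IntegrableOn.of_bound (hμ.strip_lt s t) (hh.meas hx _) (c * (1 + R)) ?_
  filter_upwards [hμ.ae_restrict s t] with z hz
  refine (hg _ hz.2 _).trans ?_
  have := hR z.1 ⟨hz.1.1.le, hz.1.2⟩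
  gcongr

theorem strip_union {s r t : ℝ} (h1 : s ≤ r) (h2 : r ≤ t) :
    strip C s t = strip C s r ∪ strip C r t := by
  rw [strip, ← Ioc_union_Ioc_eq_Ioc h1 h2]; rfl

theorem int_add {s r t : ℝ} (h1 : s ≤ r) (h2 : r ≤ t) {G : ℝ × C → E}
    (hG : IntegrableOn G (strip C s t) μ) :
    ∫ z in strip C s t, G z ∂μ = ∫ z in strip C s r, G z ∂μ + ∫ z in strip C r t, G z ∂μ := by
  have hu := strip_union (C := C) h1 h2
  rw [hu] at hG ⊢
  refine setIntegral_union ?_ (measurableSet_strip _ _) hG.left_of_union hG.right_of_union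
  exact Disjoint.preimage _ (Ioc_disjoint_Ioc_of_le le_rfl)

/-- base-point form gives increments -/
theorem Mot.of_base (hh : Good Λ h) (hμ : Ctl Λ μ) {a b : ℝ} {x : ℝ → E} {x0 : E} (hx : Continuous x)
    (hx' : ∀ t ∈ Icc a b, x t = x0 + ∫ z in strip C a t, h (x z.1) z.2 ∂μ) :
    Mot h μ a b x := by
  refine ⟨hx, fun s t h1 h2 h3 => ?_⟩
  rw [hx' s ⟨h1, h2.trans h3⟩, hx' t ⟨h1.trans h2, h3⟩,
    int_add h1 h2 (hh.integrableOn hμ hx a t)]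
  abel

theorem Mot.mono {a b a' b' : ℝ} {x : ℝ → E} (hx : Mot h μ a b x) (h1 : a ≤ a') (h2 : b' ≤ b) :
    Mot h μ a' b' x :=
  ⟨hx.cont, fun s t hs hst ht => hx.inc s t (h1.trans hs) hst (ht.trans h2)⟩

/-- integral Gronwall inequality -/
theorem gronwall {u : ℝ → ℝ} (hu : Continuous u) {A K a b : ℝ} (hK : 0 ≤ K)
    (h : ∀ t ∈ Icc a b, u t ≤ A + K * ∫ r in a..t, u r) :
    ∀ t ∈ Icc a b, u t ≤ A * Real.exp (K * (t - a)) := by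
  intro t ht
  have hd : ∀ s, HasDerivAt (fun s => A + K * ∫ r in a..s, u r) (K * u s) s := fun s =>
    ((intervalIntegral.integral_hasDerivAt_right (hu.intervalIntegrable _ _)
      (hu.stronglyMeasurableAtFilter _ _) hu.continuousAt).const_mul K).const_add A
  have := le_gronwallBound_of_liminf_deriv_right_le (f := fun s => A + K * ∫ r in a..s, u r)
    (f' := fun s => K * u s) (δ := A) (K := K) (ε := 0) (a := a) (b := b)
    (fun s _ => (hd s).continuousAt.continuousWithinAt)
    (fun s _ r hr => ((hd s).hasDerivWithinAt (s := Ici s)).liminf_right_slope_le hr)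
    (by simp)
    (fun s hs => by simpa using mul_le_mul_of_nonneg_left (h s ⟨hs.1, hs.2.le⟩) hK) t ht
  rw [gronwallBound_ε0] at this
  exact (h t ht).trans this

/-- a priori bound -/
theorem Mot.bound (hμ : Ctl Λ μ) {c : ℝ} (hc : 0 ≤ c)
    (hg : ∀ b ∈ Λ, ∀ x, ‖h x b‖ ≤ c * (1 + ‖x‖)) {a b : ℝ} {x : ℝ → E} (hx : Mot h μ a b x) :
    ∀ t ∈ Icc a b, ‖x t‖ ≤ (1 + ‖x a‖) * Real.exp (c * (t - a)) := by
  have key : ∀ t ∈ Icc a b, 1 + ‖x t‖ ≤ (1 + ‖x a‖) * Real.exp (c * (t - a)) := by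
    apply gronwall (u := fun t => 1 + ‖x t‖) (continuous_const.add hx.cont.norm) hc
    intro t ht
    have h1 := hx.inc a t le_rfl ht.1 ht.2
    have h2 := hμ.norm_int_le ht.1 (G := fun z => h (x z.1) z.2) (u := fun r => c * (1 + ‖x r‖))
      (continuous_const.mul (continuous_const.add hx.cont.norm)) (fun r => by positivity)
      (fun z _ hz2 => hg _ hz2 _)
    rw [← h1, intervalIntegral.integral_const_mul] at h2
    have h3 : ‖x t‖ ≤ ‖x a‖ + ‖x t - x a‖ := by
      simpa using norm_add_le (x a) (x t - x a)
    linarith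
  intro t ht
  have := key t ht
  linarith

/-- stability estimate -/
theorem Mot.dist_le (hh : Good Λ h) (hμ : Ctl Λ μ) {L R : ℝ} (hL : 0 ≤ L)
    (hlip : ∀ b ∈ Λ, ∀ x y, ‖x‖ ≤ R → ‖y‖ ≤ R → ‖h x b - h y b‖ ≤ L * ‖x - y‖)
    {a b : ℝ} {x y : ℝ → E} (hx : Mot h μ a b x) (hy : Mot h μ a b y)
    (hxR : ∀ t ∈ Icc a b, ‖x t‖ ≤ R) (hyR : ∀ t ∈ Icc a b, ‖y t‖ ≤ R) :
    ∀ t ∈ Icc a b, ‖x t - y t‖ ≤ ‖x a - y a‖ * Real.exp (L * (t - a)) := by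
  apply gronwall (u := fun t => ‖x t - y t‖) (hx.cont.sub hy.cont).norm hL
  intro t ht
  have h1 := hx.inc a t le_rfl ht.1 ht.2
  have h1' := hy.inc a t le_rfl ht.1 ht.2
  have h2 := hμ.norm_int_le ht.1 (G := fun z => h (x z.1) z.2 - h (y z.1) z.2)
    (u := fun r => L * ‖x r - y r‖)
    (continuous_const.mul (hx.cont.sub hy.cont).norm) (fun r => by positivity)
    (fun z hz hz2 => hlip _ hz2 _ _ (hxR _ ⟨hz.1.le, hz.2.trans ht.2⟩)
      (hyR _ ⟨hz.1.le, hz.2.trans ht.2⟩))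
  rw [integral_sub (hh.integrableOn hμ hx.cont a t) (hh.integrableOn hμ hy.cont a t),
    ← h1, ← h1', intervalIntegral.integral_const_mul] at h2
  have h3 : ‖x t - y t‖ ≤ ‖x a - y a‖ + ‖(x t - x a) - (y t - y a)‖ := by
    have := norm_add_le (x a - y a) ((x t - x a) - (y t - y a))
    rwa [show x a - y a + ((x t - x a) - (y t - y a)) = x t - y t by abel] at this
  linarith

/-- bound on all motions from a ball over bounded time -/
theorem Good.flow_bound (hh : Good Λ h) (R T : ℝ) : ∃ R' : ℝ, 0 ≤ R' ∧
    ∀ μ : Measure (ℝ × C), Ctl Λ μ → ∀ (a b : ℝ) (x : ℝ → E), b - a ≤ T → Mot h μ a b x →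
      ‖x a‖ ≤ R → ∀ t ∈ Icc a b, ‖x t‖ ≤ R' := by
  obtain ⟨c, hc, hg⟩ := hh.grow
  refine ⟨(1 + |R|) * Real.exp (c * |T|), by positivity, ?_⟩
  intro μ hμ a b x hT hx hxa t ht
  refine (hx.bound hμ hc hg t ht).trans ?_
  have : t - a ≤ |T| := by linarith [le_abs_self T, ht.2]
  have h2 := le_abs_self R
  gcongr
  exact hxa.trans h2

/-- uniform Lipschitz dependence on the initial point -/
theorem Good.flow_lip (hh : Good Λ h) (R T : ℝ) : ∃ K : ℝ, 0 ≤ K ∧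
    ∀ μ : Measure (ℝ × C), Ctl Λ μ → ∀ (a b : ℝ) (x y : ℝ → E), b - a ≤ T → Mot h μ a b x →
      Mot h μ a b y → ‖x a‖ ≤ R → ‖y a‖ ≤ R → ∀ t ∈ Icc a b, ‖x t - y t‖ ≤ K * ‖x a - y a‖ := by
  obtain ⟨R', _, hR'⟩ := hh.flow_bound R T
  obtain ⟨L, hL, hlip⟩ := hh.lip R'
  refine ⟨Real.exp (L * |T|), by positivity, ?_⟩
  intro μ hμ a b x y hT hx hy hxa hya t ht
  refine (hx.dist_le hh hμ hL hlip hy (hR' μ hμ a b x hT hx hxa)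
    (hR' μ hμ a b y hT hy hya) t ht).trans ?_
  have : t - a ≤ |T| := by linarith [le_abs_self T, ht.2]
  rw [mul_comm]
  gcongr

theorem Mot.unique (hh : Good Λ h) (hμ : Ctl Λ μ) {a b : ℝ} {x y : ℝ → E} (hx : Mot h μ a b x)
    (hy : Mot h μ a b y) (hxy : x a = y a) : ∀ t ∈ Icc a b, x t = y t := by
  intro t ht
  obtain ⟨K, _, hK⟩ := hh.flow_lip ‖x a‖ (b - a)
  have := hK μ hμ a b x y le_rfl hx hy le_rfl (by rw [hxy]) t ht
  rw [hxy, sub_self, norm_zero, mul_zero] at this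
  exact sub_eq_zero.1 (norm_le_zero_iff.1 this)

end Slide

namespace Slide
set_option linter.unusedSectionVars false
open Set Filter Topology

variable {E : Type*} [NormedAddCommGroup E] [NormedSpace ℝ E] [ProperSpace E]
variable {C : Type*} [TopologicalSpace C] [MeasurableSpace C] [BorelSpace C]
  [SecondCountableTopology C]
variable {Λ : Set C} {μ : Measure (ℝ × C)} {h : E → C → E}

theorem strip_subset {a b s t : ℝ} (h1 : a ≤ s) (h2 : t ≤ b) : strip C s t ⊆ strip C a b :=
  preimage_mono (Ioc_subset_Ioc h1 h2)

theorem Mot.congr {a b : ℝ} {x x' : ℝ → E} {μ' : Measure (ℝ × C)} (hx : Mot h μ a b x)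
    (hx' : Continuous x') (heq : ∀ t ∈ Icc a b, x' t = x t)
    (hμ : μ'.restrict (strip C a b) = μ.restrict (strip C a b)) : Mot h μ' a b x' := by
  refine ⟨hx', fun s t h1 h2 h3 => ?_⟩
  rw [heq s ⟨h1, h2.trans h3⟩, heq t ⟨h1.trans h2, h3⟩, hx.inc s t h1 h2 h3]
  have hr : μ'.restrict (strip C s t) = μ.restrict (strip C s t) := by
    have := congrArg (fun ν => Measure.restrict ν (strip C s t)) hμ
    simpa only [Measure.restrict_restrict (measurableSet_strip (C := C) s t),
      inter_eq_left.2 (strip_subset (C := C) h1 h3)] using this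
  rw [hr]
  refine setIntegral_congr_fun (measurableSet_strip s t) fun z hz => ?_
  have hz' : z.1 ∈ Ioc s t := hz
  simp only [heq z.1 ⟨h1.trans hz'.1.le, hz'.2.trans h3⟩]

theorem Mot.join (hh : Good Λ h) (hμ : Ctl Λ μ) {a b c : ℝ} {x : ℝ → E}
    (hx : Mot h μ a c x) (hy : Mot h μ c b x) : Mot h μ a b x := by
  refine ⟨hx.cont, fun s t h1 h2 h3 => ?_⟩
  rcases le_total t c with htc | htc
  · exact hx.inc s t h1 h2 htc
  rcases le_total c s with hcs | hcs
  · exact hy.inc s t hcs h2 h3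
  rw [int_add hcs htc (hh.integrableOn hμ hx.cont s t), ← hx.inc s c h1 hcs le_rfl,
    ← hy.inc c t le_rfl htc h3]
  abel

/-- gluing of two curves -/
def glue (x y : ℝ → E) (c t : ℝ) : E := x (min t c) + y (max t c) - x c

theorem glue_cont {x y : ℝ → E} (hx : Continuous x) (hy : Continuous y) (c : ℝ) :
    Continuous (glue x y c) := by
  unfold glue; fun_prop

theorem glue_left {x y : ℝ → E} {c t : ℝ} (hxy : x c = y c) (ht : t ≤ c) :
    glue x y c t = x t := by
  simp [glue, ht, hxy]

theorem glue_right {x y : ℝ → E} {c t : ℝ} (ht : c ≤ t) :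
    glue x y c t = y t := by
  simp [glue, ht]

theorem Mot.glue (hh : Good Λ h) (hμ : Ctl Λ μ) {a b c : ℝ} {x y : ℝ → E}
    (hx : Mot h μ a c x) (hy : Mot h μ c b y) (hxy : x c = y c) :
    Mot h μ a b (glue x y c) :=
  Mot.join hh hμ
    (hx.congr (glue_cont hx.cont hy.cont c) (fun _ ht => glue_left hxy ht.2) rfl)
    (hy.congr (glue_cont hx.cont hy.cont c) (fun _ ht => glue_right ht.1) rfl)

theorem prim_continuousOn (hμ : Ctl Λ μ) {a b B : ℝ} (hB : 0 ≤ B) {G : ℝ × C → E}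
    (hG : ∀ z : ℝ × C, z.1 ∈ Icc a b → z.2 ∈ Λ → ‖G z‖ ≤ B)
    (hGi : IntegrableOn G (strip C a b) μ) :
    ContinuousOn (fun t => ∫ z in strip C a t, G z ∂μ) (Icc a b) := by
  have key : ∀ s ∈ Icc a b, ∀ t ∈ Icc a b, s ≤ t →
      dist (∫ z in strip C a s, G z ∂μ) (∫ z in strip C a t, G z ∂μ) ≤ B * dist s t := by
    intro s hs t ht hst
    rw [int_add hs.1 hst (hGi.mono_set (strip_subset le_rfl ht.2)), dist_eq_norm, dist_eq_norm]
    have := hμ.norm_int_le_const hst (G := G) hB (fun z hz hz2 => hG z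
      ⟨hs.1.trans hz.1.le, hz.2.trans ht.2⟩ hz2)
    rw [sub_add_cancel_left, norm_neg, Real.norm_eq_abs, abs_sub_comm, abs_of_nonneg (by linarith)]
    exact this
  apply LipschitzOnWith.continuousOn (K := B.toNNReal)
  apply LipschitzOnWith.of_dist_le_mul
  intro s hs t ht
  rw [Real.coe_toNNReal _ hB]
  rcases le_total s t with hst | hst
  · exact key s hs t ht hst
  · rw [dist_comm, dist_comm s]; exact key t ht s hs hst

/-- short-time existence for globally Lipschitz right-hand sides -/
theorem exists_short (hh : Good Λ h) (hμ : Ctl Λ μ) {L : ℝ} (hL : 0 ≤ L)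
    (hlip : ∀ b ∈ Λ, ∀ x y, ‖h x b - h y b‖ ≤ L * ‖x - y‖) {a b : ℝ} (hab : a ≤ b)
    (hs : L * (b - a) ≤ 1 / 2) (x0 : E) : ∃ x, Mot h μ a b x ∧ x a = x0 := by
  have hext : ∀ u : C(Icc a b, E), Continuous (IccExtend hab u) := fun u =>
    u.continuous.Icc_extend'
  have hTc : ∀ u : C(Icc a b, E), Continuous fun t : Icc a b =>
      x0 + ∫ z in strip C a t, h (IccExtend hab u z.1) z.2 ∂μ := by
    intro u
    obtain ⟨c, hc, hg⟩ := hh.grow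
    obtain ⟨R, hR0, hR⟩ := exists_bound (hext u) a b
    have := prim_continuousOn hμ (a := a) (b := b) (B := c * (1 + R)) (by positivity)
      (G := fun z => h (IccExtend hab u z.1) z.2) (fun z hz hz2 => by
        refine (hg _ hz2 _).trans ?_
        have := hR z.1 hz
        gcongr) (hh.integrableOn hμ (hext u) a b)
    exact continuous_const.add (continuousOn_iff_continuous_domRestrict.1 this)
  let T : C(Icc a b, E) → C(Icc a b, E) := fun u => ⟨_, hTc u⟩
  have hT : ContractingWith (1 / 2) T := by
    refine ⟨by norm_num, LipschitzWith.of_dist_le_mul fun u w => ?_⟩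
    rw [ContinuousMap.dist_le (by positivity)]
    intro t
    change dist (x0 + ∫ z in strip C a t, h (IccExtend hab u z.1) z.2 ∂μ)
      (x0 + ∫ z in strip C a t, h (IccExtend hab w z.1) z.2 ∂μ) ≤ _
    rw [dist_add_left, dist_eq_norm, ← integral_sub (hh.integrableOn hμ (hext u) a t)
      (hh.integrableOn hμ (hext w) a t)]
    have := hμ.norm_int_le_const t.2.1 (G := fun z => h (IccExtend hab u z.1) z.2 -
      h (IccExtend hab w z.1) z.2) (B := L * dist u w) (by positivity) (fun z _ hz2 => by
        refine (hlip _ hz2 _ _).trans ?_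
        rw [← dist_eq_norm]
        have := ContinuousMap.dist_apply_le_dist (f := u) (g := w) (projIcc a b hab z.1)
        exact mul_le_mul_of_nonneg_left this hL)
    refine this.trans ?_
    have h1 : (t : ℝ) - a ≤ b - a := by linarith [t.2.2]
    have h2 : L * (t - a) ≤ 1 / 2 := (mul_le_mul_of_nonneg_left h1 hL).trans hs
    have h3 : (0:ℝ) ≤ dist u w := dist_nonneg
    push_cast
    nlinarith
  have : Nonempty C(Icc a b, E) := ⟨0⟩
  set u := hT.fixedPoint T with hu
  have hfix : T u = u := hT.fixedPoint_isFixedPt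
  have hval : ∀ t ∈ Icc a b, IccExtend hab u t =
      x0 + ∫ z in strip C a t, h (IccExtend hab u z.1) z.2 ∂μ := by
    intro t ht
    rw [IccExtend_of_mem _ _ ht]
    conv_lhs => rw [← hfix]
    rfl
  refine ⟨IccExtend hab u, Mot.of_base hh hμ (hext u) hval, ?_⟩
  rw [hval a ⟨le_rfl, hab⟩]
  simp [strip]

theorem exists_lip (hh : Good Λ h) (hμ : Ctl Λ μ) {L : ℝ} (hL : 0 ≤ L)
    (hlip : ∀ b ∈ Λ, ∀ x y, ‖h x b - h y b‖ ≤ L * ‖x - y‖) {a b : ℝ} (hab : a ≤ b)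
    (x0 : E) : ∃ x, Mot h μ a b x ∧ x a = x0 := by
  have key : ∀ n : ℕ, ∀ a b : ℝ, a ≤ b → L * (b - a) ≤ n * (1 / 2) → ∀ x0 : E,
      ∃ x, Mot h μ a b x ∧ x a = x0 := by
    intro n
    induction n with
    | zero =>
      intro a b hab hs x0
      exact exists_short hh hμ hL hlip hab (hs.trans (by norm_num)) x0
    | succ n ih =>
      intro a b hab hs x0
      rcases le_or_gt (L * (b - a)) (1 / 2) with h1 | h1
      · exact exists_short hh hμ hL hlip hab h1 x0
      have hLpos : 0 < L := by
        rcases hL.eq_or_lt with h0 | h0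
        · rw [← h0] at h1; norm_num at h1
        · exact h0
      set c := a + 1 / (2 * L) with hc
      have hLc : L * (c - a) = 1 / 2 := by rw [hc]; field_simp; ring
      have hac : a ≤ c := by rw [hc]; linarith [show 0 < 1 / (2 * L) by positivity]
      have hcb : c ≤ b := by
        by_contra hcon
        push Not at hcon
        nlinarith
      obtain ⟨x, hx, hxa⟩ := exists_short hh hμ hL hlip hac hLc.le x0
      push_cast at hs
      obtain ⟨y, hy, hyc⟩ := ih c b hcb (by nlinarith) (x c)
      exact ⟨glue x y c, hx.glue hh hμ hy hyc.symm, by rw [glue_left hyc.symm hac, hxa]⟩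
  obtain ⟨n, hn⟩ := exists_nat_ge (L * (b - a) * 2)
  exact key n a b hab (by linarith) x0

/-- radial truncation -/
def trunc (R : ℝ) (x : E) : E := (R / max R ‖x‖) • x

theorem trunc_of_le {R : ℝ} (hR : 0 < R) {x : E} (hx : ‖x‖ ≤ R) : trunc R x = x := by
  rw [trunc, max_eq_left hx, div_self hR.ne', one_smul]

theorem trunc_norm {R : ℝ} (hR : 0 < R) (x : E) : ‖trunc R x‖ ≤ R := by
  have hm : 0 < max R ‖x‖ := lt_max_of_lt_left hR
  rw [trunc, norm_smul, Real.norm_of_nonneg (by positivity), div_mul_eq_mul_div, div_le_iff₀ hm]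
  exact mul_le_mul_of_nonneg_left (le_max_right _ _) hR.le

theorem trunc_norm' {R : ℝ} (hR : 0 < R) (x : E) : ‖trunc R x‖ ≤ ‖x‖ := by
  have hm : 0 < max R ‖x‖ := lt_max_of_lt_left hR
  rw [trunc, norm_smul, Real.norm_of_nonneg (by positivity), div_mul_eq_mul_div, div_le_iff₀ hm,
    mul_comm]
  exact mul_le_mul_of_nonneg_left (le_max_left _ _) (norm_nonneg _)

theorem trunc_cont {R : ℝ} (hR : 0 < R) : Continuous (trunc R : E → E) := by
  unfold trunc
  refine Continuous.smul (Continuous.div continuous_const (by fun_prop) fun x => ?_) continuous_id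
  exact (lt_max_of_lt_left hR).ne'

theorem trunc_lip {R : ℝ} (hR : 0 < R) (x y : E) : ‖trunc R x - trunc R y‖ ≤ 2 * ‖x - y‖ := by
  have hm : 0 < max R ‖x‖ := lt_max_of_lt_left hR
  have hm' : 0 < max R ‖y‖ := lt_max_of_lt_left hR
  have hx1 : R ≤ max R ‖x‖ := le_max_left _ _
  have hy1 : ‖y‖ ≤ max R ‖y‖ := le_max_right _ _
  have hd : |max R ‖y‖ - max R ‖x‖| ≤ ‖x - y‖ := by
    have h1 := abs_max_sub_max_le_abs ‖y‖ ‖x‖ R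
    rw [max_comm _ R, max_comm _ R] at h1
    have h2 := abs_norm_sub_norm_le y x
    rw [norm_sub_rev] at h2
    exact h1.trans h2
  unfold trunc
  generalize max R ‖x‖ = m at *
  generalize max R ‖y‖ = m' at *
  have e : (R / m) • x - (R / m') • y = (R / m) • (x - y) + (R / m - R / m') • y := by
    module
  have e2 : R / m - R / m' = (R / m) * ((m' - m) / m') := by field_simp
  have hq : R / m ≤ 1 := (div_le_one hm).2 hx1
  rw [e]
  refine (norm_add_le _ _).trans ?_
  rw [norm_smul, norm_smul, Real.norm_of_nonneg (show 0 ≤ R / m by positivity), e2, norm_mul,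
    Real.norm_of_nonneg (show 0 ≤ R / m by positivity), norm_div, Real.norm_eq_abs,
    Real.norm_of_nonneg hm'.le]
  have h1 : R / m * ‖x - y‖ ≤ ‖x - y‖ := mul_le_of_le_one_left (norm_nonneg _) hq
  have h2 : R / m * (|m' - m| / m') * ‖y‖ ≤ ‖x - y‖ := by
    calc R / m * (|m' - m| / m') * ‖y‖ ≤ 1 * (|m' - m| / m') * m' := by gcongr
      _ = |m' - m| := by field_simp
      _ ≤ _ := hd
  linarith

theorem exists_mot (hh : Good Λ h) (hμ : Ctl Λ μ) {a b : ℝ} (hab : a ≤ b)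
    (x0 : E) : ∃ x, Mot h μ a b x ∧ x a = x0 := by
  obtain ⟨c, hc, hg⟩ := hh.grow
  set R := (1 + ‖x0‖) * Real.exp (c * (b - a)) with hR
  have hR0 : 0 < R := by positivity
  obtain ⟨L, hL, hlip⟩ := hh.lip R
  have hlip' : ∀ b ∈ Λ, ∀ x y, ‖h (trunc R x) b - h (trunc R y) b‖ ≤ L * 2 * ‖x - y‖ := by
    intro b hb x y
    refine (hlip b hb _ _ (trunc_norm hR0 x) (trunc_norm hR0 y)).trans ?_
    rw [mul_assoc]
    exact mul_le_mul_of_nonneg_left (trunc_lip hR0 x y) hL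
  have hgrow' : ∀ b ∈ Λ, ∀ x, ‖h (trunc R x) b‖ ≤ c * (1 + ‖x‖) := by
    intro b hb x
    refine (hg b hb _).trans ?_
    have := trunc_norm' hR0 x
    gcongr
  have hh' : Good Λ (fun x b => h (trunc R x) b) := by
    refine ⟨hh.mset, hh.cont.comp (((trunc_cont hR0).comp continuous_fst).prodMk continuous_snd),
      fun _ => ⟨L * 2, by positivity, fun b hb x y _ _ => hlip' b hb x y⟩, ⟨c, hc, hgrow'⟩⟩
  obtain ⟨x, hx, hxa⟩ := exists_lip hh' hμ (by positivity) hlip' hab x0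
  refine ⟨x, ⟨hx.cont, fun s t h1 h2 h3 => ?_⟩, hxa⟩
  rw [hx.inc s t h1 h2 h3]
  refine setIntegral_congr_fun (measurableSet_strip s t) fun z hz => ?_
  have hz' : z.1 ∈ Ioc s t := hz
  have hzm : z.1 ∈ Icc a b := ⟨h1.trans hz'.1.le, hz'.2.trans h3⟩
  have hb := hx.bound hμ hc hgrow' z.1 hzm
  rw [hxa] at hb
  have : ‖x z.1‖ ≤ R := hb.trans (by
    rw [hR]
    have : z.1 - a ≤ b - a := by linarith [hzm.2]
    gcongr)
  simp only [trunc_of_le hR0 this]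

end Slide

namespace Slide
set_option linter.unusedSectionVars false
open Set Filter Topology

variable {E : Type*} [NormedAddCommGroup E] [NormedSpace ℝ E] [ProperSpace E]
variable {C : Type*} [TopologicalSpace C] [MeasurableSpace C] [BorelSpace C]
  [SecondCountableTopology C]
variable {Λ : Set C} {μ : Measure (ℝ × C)} {h : E → C → E}

/-- flows of the constant-control systems -/
structure Flow (Λ : Set C) (h : E → C → E) (H : C → ℝ → E → E) : Prop where
  zero : ∀ b ∈ Λ, ∀ x, H b 0 x = x
  deriv : ∀ b ∈ Λ, ∀ x τ, HasDerivAt (fun τ' => H b τ' x) (h (H b τ x) b) τ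

/-- constant control -/
def cc (b : C) : Measure (ℝ × C) := volume.map fun t : ℝ => (t, b)

theorem cc_fst (b : C) : (cc b).map Prod.fst = volume := by
  rw [cc, Measure.map_map measurable_fst (by fun_prop)]
  exact Measure.map_id

theorem cc_ae (hm : MeasurableSet Λ) {b : C} (hb : b ∈ Λ) : ∀ᵐ z ∂(cc b), z.2 ∈ Λ := by
  rw [cc, ae_map_iff (by fun_prop) (measurable_snd hm)]
  exact Eventually.of_forall fun _ => hb

theorem cc_ctl (hm : MeasurableSet Λ) {b : C} (hb : b ∈ Λ) : Ctl Λ (cc b) :=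
  ⟨(cc_fst b).le, cc_ae hm hb⟩

theorem Flow.mot {H : C → ℝ → E → E} (hH : Flow Λ h H) (hh : Good Λ h) {b : C} (hb : b ∈ Λ)
    (t1 : ℝ) (x : E) (a a' : ℝ) : Mot h (cc b) a a' fun t => H b (t - t1) x := by
  have hd : ∀ t, HasDerivAt (fun t => H b (t - t1) x) (h (H b (t - t1) x) b) t := fun t =>
    (hH.deriv b hb x (t - t1)).comp_sub_const t t1
  have hc : Continuous fun t => H b (t - t1) x :=
    continuous_iff_continuousAt.2 fun t => (hd t).continuousAt
  have hc2 : Continuous fun t => h (H b (t - t1) x) b :=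
    hh.cont.comp (hc.prodMk continuous_const)
  refine ⟨hc, fun s t _ h2 _ => ?_⟩
  rw [cc, setIntegral_map (measurableSet_strip s t) (hh.meas hc _) (by fun_prop)]
  have : (fun t : ℝ => (t, b)) ⁻¹' strip C s t = Ioc s t := rfl
  rw [this, ← intervalIntegral.integral_of_le h2]
  exact (intervalIntegral.integral_eq_sub_of_hasDerivAt (fun r _ => hd r)
    (hc2.intervalIntegrable _ _)).symm

/-- Lipschitz on bounded sets -/
def LipB (φ : E → E) : Prop := ∀ R : ℝ, ∃ K : ℝ, 0 ≤ K ∧ ∀ x y, ‖x‖ ≤ R → ‖y‖ ≤ R →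
  ‖φ x - φ y‖ ≤ K * ‖x - y‖

theorem LipB.continuous {φ : E → E} (hφ : LipB φ) : Continuous φ := by
  rw [continuous_iff_continuousAt]
  intro x
  obtain ⟨K, hK, hK'⟩ := hφ (‖x‖ + 1)
  have : LipschitzOnWith K.toNNReal φ (Metric.closedBall x 1) := by
    apply LipschitzOnWith.of_dist_le_mul
    intro y hy z hz
    rw [Real.coe_toNNReal _ hK, dist_eq_norm, dist_eq_norm]
    have aux : ∀ y ∈ Metric.closedBall x 1, ‖y‖ ≤ ‖x‖ + 1 := by
      intro y hy
      rw [Metric.mem_closedBall, dist_eq_norm] at hy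
      have := norm_add_le x (y - x)
      rw [add_sub_cancel] at this
      linarith
    exact hK' y z (aux y hy) (aux z hz)
  exact this.continuousOn.continuousAt (Metric.closedBall_mem_nhds x one_pos)

theorem Flow.lipB {H : C → ℝ → E → E} (hH : Flow Λ h H) (hh : Good Λ h) {b : C} (hb : b ∈ Λ)
    (T R : ℝ) : ∃ K : ℝ, 0 ≤ K ∧ ∀ τ ∈ Icc 0 T, ∀ x y, ‖x‖ ≤ R → ‖y‖ ≤ R →
      ‖H b τ x - H b τ y‖ ≤ K * ‖x - y‖ := by
  obtain ⟨K, hK, hK'⟩ := hh.flow_lip R T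
  refine ⟨K, hK, fun τ hτ x y hx hy => ?_⟩
  have := hK' (cc b) (cc_ctl hh.mset hb) 0 T _ _ (by simp) (hH.mot hh hb 0 x 0 T)
    (hH.mot hh hb 0 y 0 T) (by simpa [hH.zero b hb] using hx)
    (by simpa [hH.zero b hb] using hy) τ hτ
  simpa [hH.zero b hb] using this

/-- filter of base points and positive increments -/
abbrev NF (x : E) : Filter (E × ℝ) := 𝓝 x ×ˢ 𝓝[>] 0

theorem NF_pos (x : E) : ∀ᶠ q in NF x, 0 < q.2 :=
  tendsto_snd.eventually (eventually_mem_nhdsWithin (a := (0:ℝ)) (s := Ioi 0))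

theorem NF_lt (x : E) {δ : ℝ} (hδ : 0 < δ) : ∀ᶠ q in NF x, q.2 < δ :=
  tendsto_snd.eventually (mem_nhdsWithin_of_mem_nhds (Iio_mem_nhds hδ))

theorem NF_near (x : E) {δ : ℝ} (hδ : 0 < δ) : ∀ᶠ q in NF x, ‖q.1 - x‖ < δ := by
  have : ∀ᶠ y in 𝓝 x, ‖y - x‖ < δ := by
    filter_upwards [Metric.ball_mem_nhds x hδ] with y hy
    rwa [← dist_eq_norm]
  exact tendsto_fst.eventually this

theorem flow_approx {H : C → ℝ → E → E} (hH : Flow Λ h H) (hh : Good Λ h) {b : C} (hb : b ∈ Λ)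
    (x : E) {ε : ℝ} (hε : 0 < ε) :
    ∀ᶠ q in NF x, ‖H b q.2 q.1 - q.1 - q.2 • h x b‖ ≤ ε * q.2 := by
  have hcont : Continuous fun y => h y b := hh.cont.comp (continuous_id.prodMk continuous_const)
  obtain ⟨δ, hδ, hδ'⟩ := Metric.continuous_iff.1 hcont x ε hε
  obtain ⟨K, hK, hK'⟩ := hH.lipB hh hb 1 (‖x‖ + 1)
  have hHc : ContinuousAt (fun τ => H b τ x) 0 := (hH.deriv b hb x 0).continuousAt
  obtain ⟨k0, hk0, hk0'⟩ := Metric.continuousAt_iff.1 hHc (δ / 2) (by positivity)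
  filter_upwards [NF_pos x, NF_lt x hk0, NF_lt x one_pos, NF_near x one_pos,
    NF_near x (show 0 < δ / (2 * (K + 1)) by positivity)] with q hq0 hqk hq1 hqx hqK
  have hqn : ‖q.1‖ ≤ ‖x‖ + 1 := by
    have := norm_add_le x (q.1 - x)
    rw [add_sub_cancel] at this
    linarith
  have hd : ∀ r ∈ Icc 0 q.2, HasDerivWithinAt (fun r => H b r q.1 - r • h x b)
      (h (H b r q.1) b - (1 : ℝ) • h x b) (Icc 0 q.2) r := fun r _ =>
    ((hH.deriv b hb q.1 r).sub ((hasDerivAt_id r).smul_const (h x b))).hasDerivWithinAt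
  have := norm_image_sub_le_of_norm_deriv_le_segment' hd (C := ε) (fun r hr => by
    rw [one_smul, ← dist_eq_norm]
    apply le_of_lt
    apply hδ'
    have h1 : ‖H b r q.1 - H b r x‖ ≤ K * ‖q.1 - x‖ :=
      hK' r ⟨hr.1, by linarith [hr.2]⟩ _ _ hqn (by linarith)
    have h2 : dist (H b r x) (H b 0 x) < δ / 2 := hk0' (by
      rw [Real.dist_eq, sub_zero, abs_of_nonneg hr.1]; linarith [hr.2])
    rw [hH.zero b hb] at h2
    have h3 : K * ‖q.1 - x‖ ≤ δ / 2 := by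
      have h4 : (K + 1) * ‖q.1 - x‖ ≤ (K + 1) * (δ / (2 * (K + 1))) :=
        mul_le_mul_of_nonneg_left hqK.le (by positivity)
      have h5 : (K + 1) * (δ / (2 * (K + 1))) = δ / 2 := by field_simp
      nlinarith [norm_nonneg (q.1 - x)]
    have h6 := dist_triangle (H b r q.1) (H b r x) x
    rw [dist_eq_norm (H b r q.1) (H b r x)] at h6
    linarith) q.2 ⟨hq0.le, le_rfl⟩
  simp only [hH.zero b hb, zero_smul, sub_zero] at this
  rwa [sub_right_comm] at this

/-- strict one-sided directional derivatives of `φ` at `x` -/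
def SD (φ : E → E) (x : E) : Set (E × E) :=
  {p | ∀ ε > 0, ∀ᶠ q in NF x, ‖φ (q.1 + q.2 • p.1) - φ q.1 - q.2 • p.2‖ ≤ ε * q.2}

theorem SD_zero (φ : E → E) (x : E) : (0 : E × E) ∈ SD φ x := by
  intro ε hε
  filter_upwards [NF_pos x] with q hq
  simp; positivity

theorem SD_smul {φ : E → E} {x : E} {p : E × E} (hp : p ∈ SD φ x) {l : ℝ} (hl : 0 ≤ l) :
    l • p ∈ SD φ x := by
  rcases hl.eq_or_lt with h0 | h0
  · rw [← h0, zero_smul]; exact SD_zero φ x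
  intro ε hε
  have hscale : Tendsto (fun k : ℝ => l * k) (𝓝[>] 0) (𝓝[>] 0) := by
    refine tendsto_nhdsWithin_iff.2 ⟨?_, ?_⟩
    · have : Tendsto (fun k : ℝ => l * k) (𝓝 0) (𝓝 (l * 0)) := tendsto_id.const_mul l
      rw [mul_zero] at this
      exact this.mono_left nhdsWithin_le_nhds
    · filter_upwards [self_mem_nhdsWithin] with k hk
      exact mul_pos h0 hk
  have ht : Tendsto (fun q : E × ℝ => (q.1, l * q.2)) (NF x) (NF x) :=
    tendsto_fst.prodMk (hscale.comp tendsto_snd)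
  filter_upwards [ht.eventually (hp (ε / l) (by positivity))] with q hq
  simp only [Prod.smul_fst, Prod.smul_snd, smul_smul]
  rw [mul_comm q.2 l]
  refine hq.trans (le_of_eq ?_)
  field_simp

theorem NF_shift (x w : E) : Tendsto (fun q : E × ℝ => (q.1 + q.2 • w, q.2)) (NF x) (NF x) := by
  refine Tendsto.prodMk ?_ tendsto_snd
  have h1 : Tendsto (fun q : E × ℝ => q.1 + q.2 • w) (𝓝 (x, (0:ℝ))) (𝓝 (x + (0:ℝ) • w)) :=
    Continuous.tendsto (by fun_prop) (x, (0:ℝ))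
  rw [zero_smul, add_zero, nhds_prod_eq] at h1
  exact h1.mono_left (Filter.prod_mono le_rfl nhdsWithin_le_nhds)

theorem SD_add {φ : E → E} {x : E} {p p' : E × E} (hp : p ∈ SD φ x) (hp' : p' ∈ SD φ x) :
    p + p' ∈ SD φ x := by
  intro ε hε
  filter_upwards [hp (ε / 2) (by positivity),
    (NF_shift x p.1).eventually (hp' (ε / 2) (by positivity))] with q h1 h2
  have e : φ (q.1 + q.2 • (p + p').1) - φ q.1 - q.2 • (p + p').2 =
      (φ (q.1 + q.2 • p.1 + q.2 • p'.1) - φ (q.1 + q.2 • p.1) - q.2 • p'.2) +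
      (φ (q.1 + q.2 • p.1) - φ q.1 - q.2 • p.2) := by
    simp only [Prod.fst_add, Prod.snd_add, smul_add, ← add_assoc]
    abel
  rw [e]
  refine (norm_add_le _ _).trans ?_
  linarith

theorem SD_convex (φ : E → E) (x : E) : Convex ℝ (SD φ x) := fun _ hp _ hp' _ _ ha hb _ =>
  SD_add (SD_smul hp ha) (SD_smul hp' hb)

theorem loc_est {φ : E → E} (hφ : LipB φ) (x : E) (B : ℝ) : ∃ K : ℝ, 0 ≤ K ∧
    ∀ᶠ q in NF x, ∀ w w' : E, ‖w‖ ≤ B → ‖w'‖ ≤ B →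
      ‖φ (q.1 + q.2 • w) - φ (q.1 + q.2 • w')‖ ≤ K * q.2 * ‖w - w'‖ := by
  obtain ⟨K, hK, hK'⟩ := hφ (‖x‖ + 2)
  refine ⟨K, hK, ?_⟩
  filter_upwards [NF_pos x, NF_near x one_pos, NF_lt x (show 0 < 1 / (|B| + 1) by positivity)]
    with q h0 h1 h2 w w' hw hw'
  have aux : ∀ w : E, ‖w‖ ≤ B → ‖q.1 + q.2 • w‖ ≤ ‖x‖ + 2 := by
    intro w hw
    have e : q.1 + q.2 • w = x + (q.1 - x) + q.2 • w := by abel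
    have h3 : ‖q.2 • w‖ ≤ 1 := by
      rw [norm_smul, Real.norm_of_nonneg h0.le]
      rw [lt_div_iff₀ (by positivity)] at h2
      have := le_abs_self B
      nlinarith [norm_nonneg w]
    rw [e]
    have := norm_add₃_le (a := x) (b := q.1 - x) (c := q.2 • w)
    linarith
  refine (hK' _ _ (aux w hw) (aux w' hw')).trans (le_of_eq ?_)
  rw [add_sub_add_left_eq_sub, ← smul_sub, norm_smul, Real.norm_of_nonneg h0.le, mul_assoc]

theorem SD_unif {φ : E → E} (hφ : LipB φ) (x : E) {ε : ℝ} (hε : 0 < ε) (S : Set (E × E))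
    (hS : S ⊆ closure (SD φ x)) {B : ℝ} (hB : S ⊆ Metric.closedBall 0 B) :
    ∀ᶠ q in NF x, ∀ p ∈ S, ‖φ (q.1 + q.2 • p.1) - φ q.1 - q.2 • p.2‖ ≤ ε * q.2 := by
  obtain ⟨K, hK, hK'⟩ := loc_est hφ x (B + 1)
  set η := min 1 (ε / (2 * (K + 1))) with hη
  have hη0 : 0 < η := by positivity
  have htb : TotallyBounded S :=
    ((isCompact_closedBall (0 : E × E) B).totallyBounded).subset hB
  obtain ⟨T, hT, hTf, hST⟩ := Metric.finite_approx_of_totallyBounded htb (η / 2) (by positivity)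
  have hch : ∀ t ∈ T, ∃ p' ∈ SD φ x, dist t p' < η / 2 := fun t ht =>
    Metric.mem_closure_iff.1 (hS (hT ht)) _ (by positivity)
  choose! r hr hr' using hch
  have hall : ∀ᶠ q in NF x, ∀ t ∈ T,
      ‖φ (q.1 + q.2 • (r t).1) - φ q.1 - q.2 • (r t).2‖ ≤ ε / 4 * q.2 :=
    (eventually_all_finite hTf).2 fun t ht => hr t ht (ε / 4) (by positivity)
  filter_upwards [hall, hK', NF_pos x] with q h1 h2 h0 p hp
  obtain ⟨t, ht, hpt⟩ := mem_iUnion₂.1 (hST hp)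
  rw [Metric.mem_ball] at hpt
  have hd : ‖p - r t‖ ≤ η := by
    rw [← dist_eq_norm]
    have := dist_triangle p t (r t)
    linarith [hr' t ht]
  have hpB : ‖p‖ ≤ B := by simpa using hB hp
  have hη1 : η ≤ 1 := min_le_left _ _
  have hη2 : η * (K + 1) ≤ ε / 2 := by
    have : η ≤ ε / (2 * (K + 1)) := min_le_right _ _
    calc η * (K + 1) ≤ ε / (2 * (K + 1)) * (K + 1) := by gcongr
      _ = ε / 2 := by field_simp
  have hrB : ‖r t‖ ≤ B + 1 := by
    have := norm_sub_le p (p - r t)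
    rw [sub_sub_cancel] at this
    linarith
  have hd1 : ‖p.1 - (r t).1‖ ≤ η := (norm_fst_le (p - r t)).trans hd
  have hd2 : ‖p.2 - (r t).2‖ ≤ η := (norm_snd_le (p - r t)).trans hd
  have a1 := h2 p.1 (r t).1 (by linarith [norm_fst_le p]) ((norm_fst_le _).trans hrB)
  have a2 := h1 t ht
  have a3 : ‖q.2 • (p.2 - (r t).2)‖ ≤ q.2 * η := by
    rw [norm_smul, Real.norm_of_nonneg h0.le]; gcongr
  have a1' : K * q.2 * ‖p.1 - (r t).1‖ ≤ K * q.2 * η := by gcongr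
  have e : φ (q.1 + q.2 • p.1) - φ q.1 - q.2 • p.2 =
      (φ (q.1 + q.2 • p.1) - φ (q.1 + q.2 • (r t).1)) +
      (φ (q.1 + q.2 • (r t).1) - φ q.1 - q.2 • (r t).2) - q.2 • (p.2 - (r t).2) := by
    rw [smul_sub]; abel
  rw [e]
  have b1 := norm_sub_le ((φ (q.1 + q.2 • p.1) - φ (q.1 + q.2 • (r t).1)) +
      (φ (q.1 + q.2 • (r t).1) - φ q.1 - q.2 • (r t).2)) (q.2 • (p.2 - (r t).2))
  have b2 := norm_add_le (φ (q.1 + q.2 • p.1) - φ (q.1 + q.2 • (r t).1))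
      (φ (q.1 + q.2 • (r t).1) - φ q.1 - q.2 • (r t).2)
  nlinarith

theorem SD_flow {H : C → ℝ → E → E} (hH : Flow Λ h H) (hh : Good Λ h) {b : C} (hb : b ∈ Λ)
    {φ : E → E} (hφ : LipB φ) (hcomm : ∀ τ, 0 ≤ τ → ∀ x, φ (H b τ x) = H b τ (φ x)) (x : E) :
    (h x b, h (φ x) b) ∈ SD φ x := by
  intro ε hε
  obtain ⟨K, hK, hK'⟩ := loc_est hφ x (‖h x b‖ + 1)
  have hcφ : Tendsto (fun q : E × ℝ => (φ q.1, q.2)) (NF x) (NF (φ x)) :=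
    ((hφ.continuous.tendsto x).comp tendsto_fst).prodMk tendsto_snd
  set η := min 1 (ε / (2 * (K + 1))) with hη
  have hη0 : 0 < η := by positivity
  filter_upwards [flow_approx hH hh hb x hη0,
    hcφ.eventually (flow_approx hH hh hb (φ x) (show 0 < ε / 2 by positivity)), hK', NF_pos x]
    with q h1 h2 h3 h0
  have hη1 : η ≤ 1 := min_le_left _ _
  have hη2 : η * (K + 1) ≤ ε / 2 := by
    have : η ≤ ε / (2 * (K + 1)) := min_le_right _ _
    calc η * (K + 1) ≤ ε / (2 * (K + 1)) * (K + 1) := by gcongr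
      _ = ε / 2 := by field_simp
  set w' := q.2⁻¹ • (H b q.2 q.1 - q.1) with hw'
  have hkw : q.2 • w' = H b q.2 q.1 - q.1 := by rw [hw', smul_inv_smul₀ h0.ne']
  have hdw : ‖h x b - w'‖ ≤ η := by
    have : q.2 • (h x b - w') = -(H b q.2 q.1 - q.1 - q.2 • h x b) := by
      rw [smul_sub, hkw]; abel
    have h4 : q.2 * ‖h x b - w'‖ ≤ η * q.2 := by
      rw [← Real.norm_of_nonneg h0.le, ← norm_smul, Real.norm_of_nonneg h0.le, this, norm_neg]
      exact h1
    rw [mul_comm] at h4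
    exact le_of_mul_le_mul_right h4 h0
  have hwB : ‖w'‖ ≤ ‖h x b‖ + 1 := by
    have := norm_sub_le (h x b) (h x b - w')
    rw [sub_sub_cancel] at this
    linarith
  have h5 := h3 (h x b) w' (by linarith) hwB
  rw [hkw, add_sub_cancel, hcomm _ h0.le] at h5
  have h6 : K * q.2 * ‖h x b - w'‖ ≤ K * q.2 * η := by gcongr
  have e : φ (q.1 + q.2 • h x b) - φ q.1 - q.2 • h (φ x) b =
      (φ (q.1 + q.2 • h x b) - H b q.2 (φ q.1)) + (H b q.2 (φ q.1) - φ q.1 - q.2 • h (φ x) b) := by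
    abel
  rw [e]
  refine (norm_add_le _ _).trans ?_
  nlinarith

/-- vanishing right increments force constancy -/
theorem const_of_small {D : ℝ → E} {a b : ℝ} (hD : ContinuousOn D (Icc a b))
    (hs : ∀ t ∈ Ico a b, ∀ ε > 0, ∀ᶠ k in 𝓝[>] (0:ℝ), ‖D (t + k) - D t‖ ≤ ε * k) :
    ∀ t ∈ Icc a b, D t = D a := by
  apply constant_of_has_deriv_right_zero hD
  intro t ht
  rw [hasDerivWithinAt_iff_isLittleO, Asymptotics.isLittleO_iff]
  intro ε hε
  have h1 := hs t ht ε hε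
  obtain ⟨δ, hδ, hδ'⟩ := mem_nhdsGT_iff_exists_Ioo_subset.1 h1
  filter_upwards [Ico_mem_nhdsGE (show t < t + δ by linarith [mem_Ioi.1 hδ])] with x hx
  rw [smul_zero, sub_zero]
  rcases hx.1.eq_or_lt with h2 | h2
  · rw [← h2]; simp
  have h3 : x - t ∈ Ioo 0 δ := ⟨by linarith, by linarith [hx.2]⟩
  have h4 : ‖D (t + (x - t)) - D t‖ ≤ ε * (x - t) := hδ' h3
  rw [add_sub_cancel] at h4
  rwa [Real.norm_of_nonneg h3.1.le]

theorem mean_mem {S : Set (E × E)} (hS : Convex ℝ S) (hSc : IsClosed S) (h0 : 0 ∈ S)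
    (hμ : Ctl Λ μ) {t k : ℝ} (hk : 0 < k) {G : ℝ × C → E × E}
    (hG : ∀ z : ℝ × C, z.2 ∈ Λ → G z ∈ S) (hGi : IntegrableOn G (strip C t (t + k)) μ) :
    k⁻¹ • ∫ z in strip C t (t + k), G z ∂μ ∈ S := by
  by_cases hm : μ (strip C t (t + k)) = 0
  · rw [setIntegral_measure_zero _ hm, smul_zero]; exact h0
  have h1 := hS.set_average_mem hSc hm (hμ.strip_lt _ _).ne
    (by filter_upwards [hμ.ae_restrict t (t + k)] with z hz using hG z hz.2) hGi
  rw [setAverage_eq] at h1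
  have hmr : 0 < μ.real (strip C t (t + k)) :=
    ENNReal.toReal_pos hm (hμ.strip_lt _ _).ne
  have hle : μ.real (strip C t (t + k)) ≤ k := by
    have := hμ.real_le (show t ≤ t + k by linarith)
    linarith
  have h2 := hS.smul_mem_of_zero_mem h0 h1 (t := μ.real (strip C t (t + k)) / k)
    ⟨by positivity, (div_le_one hk).2 hle⟩
  rw [smul_smul] at h2
  convert h2 using 2
  field_simp

end Slide

namespace Slide
set_option linter.unusedSectionVars false
open Set Filter Topology

variable {E : Type*} [NormedAddCommGroup E] [NormedSpace ℝ E] [ProperSpace E]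
variable {C : Type*} [TopologicalSpace C] [MeasurableSpace C] [BorelSpace C]
  [SecondCountableTopology C]
variable {Λ : Set C} {μ : Measure (ℝ × C)} {h : E → C → E}

theorem Mot.of_local (hh : Good Λ h) (hμ : Ctl Λ μ) {a b : ℝ} {y : ℝ → E} (hy : Continuous y)
    (hl : ∀ t ∈ Ico a b, ∀ ε > 0, ∀ᶠ k in 𝓝[>] (0:ℝ),
      ‖y (t + k) - y t - ∫ z in strip C t (t + k), h (y z.1) z.2 ∂μ‖ ≤ ε * k) :
    Mot h μ a b y := by
  obtain ⟨c, hc, hg⟩ := hh.grow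
  obtain ⟨R, hR0, hR⟩ := exists_bound hy a b
  have hprim := prim_continuousOn hμ (a := a) (b := b) (B := c * (1 + R)) (by positivity)
    (G := fun z => h (y z.1) z.2) (fun z h1 h2 => (hg _ h2 _).trans (by
      have := hR _ h1
      gcongr)) (hh.integrableOn hμ hy a b)
  have key := const_of_small (D := fun t => y t - ∫ z in strip C a t, h (y z.1) z.2 ∂μ)
    (hy.continuousOn.sub hprim) (by
      intro t ht ε hε
      filter_upwards [hl t ht ε hε, self_mem_nhdsWithin] with k hk hk0
      have hk0 : 0 < k := hk0
      have e : ∫ z in strip C a (t + k), h (y z.1) z.2 ∂μ =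
        ∫ z in strip C a t, h (y z.1) z.2 ∂μ + ∫ z in strip C t (t + k), h (y z.1) z.2 ∂μ :=
        int_add ht.1 (by linarith) (hh.integrableOn hμ hy a (t + k))
      rw [e]
      convert hk using 2
      abel)
  refine Mot.of_base hh hμ (x0 := y a) hy fun t ht => ?_
  have h1 := key t ht
  have h2 : strip C a a = ∅ := by simp [strip]
  simp only [h2, Measure.restrict_empty, integral_zero_measure, sub_zero] at h1
  rw [← h1]; abel

theorem loc_int (hh : Good Λ h) (hμ : Ctl Λ μ) {x : ℝ → E} (hx : Continuous x) (t : ℝ)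
    {ε : ℝ} (hε : 0 < ε) : ∀ᶠ k in 𝓝[>] (0:ℝ),
      ‖(∫ z in strip C t (t + k), h (x z.1) z.2 ∂μ) - ∫ z in strip C t (t + k), h (x t) z.2 ∂μ‖
        ≤ ε * k := by
  obtain ⟨L, hL, hlip⟩ := hh.lip (‖x t‖ + 1)
  obtain ⟨δ, hδ, hδ'⟩ := Metric.continuous_iff.1 hx t (min 1 (ε / (L + 1))) (by positivity)
  filter_upwards [Ioo_mem_nhdsGT hδ] with k hk
  rw [← integral_sub (hh.integrableOn hμ hx _ _)
    (hh.integrableOn hμ (x := fun _ => x t) continuous_const _ _)]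
  have := hμ.norm_int_le_const (show t ≤ t + k by linarith [hk.1]) hε.le
    (G := fun z => h (x z.1) z.2 - h (x t) z.2) (fun z h1 h2 => by
      have h3 := hδ' z.1 (by
        rw [Real.dist_eq, abs_of_pos (by linarith [h1.1])]; linarith [h1.2, hk.2])
      rw [dist_eq_norm] at h3
      have h4 : ‖x z.1 - x t‖ ≤ 1 := (h3.trans_le (min_le_left _ _)).le
      have h5 : ‖x z.1 - x t‖ ≤ ε / (L + 1) := (h3.trans_le (min_le_right _ _)).le
      have h6 : ‖x z.1‖ ≤ ‖x t‖ + 1 := by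
        have := norm_add_le (x t) (x z.1 - x t)
        rw [add_sub_cancel] at this
        linarith
      have h7 : (L + 1) * (ε / (L + 1)) = ε := by field_simp
      refine (hlip _ h2 _ _ h6 (by linarith)).trans ?_
      nlinarith [norm_nonneg (x z.1 - x t)])
  simpa using this

theorem push (hh : Good Λ h) {H : C → ℝ → E → E} (hH : Flow Λ h H) {φ : E → E} (hφ : LipB φ)
    (hcomm : ∀ b ∈ Λ, ∀ τ, 0 ≤ τ → ∀ x, φ (H b τ x) = H b τ (φ x)) (hμ : Ctl Λ μ) {a b : ℝ}
    {x : ℝ → E} (hx : Mot h μ a b x) : Mot h μ a b (φ ∘ x) := by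
  have hy : Continuous (φ ∘ x) := hφ.continuous.comp hx.cont
  refine Mot.of_local hh hμ hy fun t ht ε hε => ?_
  obtain ⟨c, hc, hg⟩ := hh.grow
  obtain ⟨R, hR0, hR⟩ := exists_bound hx.cont a b
  obtain ⟨K, hK, hK'⟩ := hφ (R + 1)
  set xb := x t with hxb
  set B := c * (1 + max ‖xb‖ ‖φ xb‖) with hBdef
  have hB : 0 ≤ B := by positivity
  set S := closure (SD φ xb) ∩ Metric.closedBall 0 B with hS
  have hSc : IsClosed S := isClosed_closure.inter Metric.isClosed_closedBall
  have hSx : Convex ℝ S := (SD_convex φ xb).closure.inter (convex_closedBall _ _)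
  have hS0 : (0 : E × E) ∈ S := ⟨subset_closure (SD_zero φ xb), by simpa using hB⟩
  set η := ε / (K + 3) with hη
  have hη0 : 0 < η := by positivity
  have hηe : (K + 3) * η = ε := by rw [hη]; field_simp
  have hunif := SD_unif hφ xb hη0 S inter_subset_left (B := B) inter_subset_right
  have hunif' : ∀ᶠ k in 𝓝[>] (0:ℝ), ∀ p ∈ S,
      ‖φ (xb + k • p.1) - φ xb - k • p.2‖ ≤ η * k := by
    have ht : Tendsto (fun k : ℝ => (xb, k)) (𝓝[>] 0) (NF xb) :=
      tendsto_const_nhds.prodMk tendsto_id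
    exact ht.eventually hunif
  filter_upwards [hunif', loc_int hh hμ hx.cont t hη0, loc_int hh hμ hy t hη0,
    Ioo_mem_nhdsGT (show 0 < b - t by linarith [ht.2]),
    Ioo_mem_nhdsGT (show 0 < 1 / (B + 1) by positivity)] with k h1 h2 h3 h4 h5
  have hk : 0 < k := h4.1
  have i1 := hh.integrableOn hμ (x := fun _ => xb) continuous_const t (t + k)
  have i2 := hh.integrableOn hμ (x := fun _ => φ xb) continuous_const t (t + k)
  have hmem := mean_mem hSx hSc hS0 hμ hk (t := t) (G := fun z => (h xb z.2, h (φ xb) z.2))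
    (fun z hz => ⟨subset_closure (SD_flow hH hh hz hφ (hcomm z.2 hz) xb), by
      rw [mem_closedBall_zero_iff, Prod.norm_def]
      refine max_le ((hg _ hz _).trans ?_) ((hg _ hz _).trans ?_)
      · have := le_max_left ‖xb‖ ‖φ xb‖
        rw [hBdef]; gcongr
      · have := le_max_right ‖xb‖ ‖φ xb‖
        rw [hBdef]; gcongr⟩) (i1.prodMk i2)
  rw [integral_pair i1 i2] at hmem
  set I1 := ∫ z in strip C t (t + k), h xb z.2 ∂μ with hI1
  set I2 := ∫ z in strip C t (t + k), h (φ xb) z.2 ∂μ with hI2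
  have h6 := h1 _ hmem
  simp only [Prod.smul_fst, Prod.smul_snd, smul_inv_smul₀ hk.ne'] at h6
  have h7 : x (t + k) - xb = ∫ z in strip C t (t + k), h (x z.1) z.2 ∂μ :=
    hx.inc t (t + k) ht.1 (by linarith) (by linarith [h4.2])
  rw [← h7] at h2
  have hI1B : ‖I1‖ ≤ B * k := by
    have := hmem.2
    rw [mem_closedBall_zero_iff] at this
    have h8 := (norm_fst_le _).trans this
    simp only [Prod.smul_fst, norm_smul, norm_inv, Real.norm_of_nonneg hk.le] at h8
    rwa [inv_mul_le_iff₀ hk, mul_comm] at h8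
  have hBk : B * k ≤ 1 := by
    have := h5.2
    rw [lt_div_iff₀ (by positivity)] at this
    nlinarith
  have htm : ‖xb‖ ≤ R := hR t ⟨ht.1, ht.2.le⟩
  have h9 := hK' (x (t + k)) (xb + I1)
    (by linarith [hR (t + k) ⟨by linarith [ht.1], by linarith [h4.2]⟩])
    ((norm_add_le _ _).trans (by linarith))
  have e1 : x (t + k) - (xb + I1) = x (t + k) - xb - I1 := by abel
  rw [e1] at h9
  have e2 : (φ ∘ x) (t + k) - (φ ∘ x) t -
      ∫ z in strip C t (t + k), h ((φ ∘ x) z.1) z.2 ∂μ =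
      (φ (x (t + k)) - φ (xb + I1)) + (φ (xb + I1) - φ xb - I2) -
      ((∫ z in strip C t (t + k), h ((φ ∘ x) z.1) z.2 ∂μ) - I2) := by
    simp only [Function.comp_apply, ← hxb]; abel
  rw [e2]
  have a1 := norm_sub_le ((φ (x (t + k)) - φ (xb + I1)) + (φ (xb + I1) - φ xb - I2))
      ((∫ z in strip C t (t + k), h ((φ ∘ x) z.1) z.2 ∂μ) - I2)
  have a2 := norm_add_le (φ (x (t + k)) - φ (xb + I1)) (φ (xb + I1) - φ xb - I2)
  have a3 : ‖(∫ z in strip C t (t + k), h ((φ ∘ x) z.1) z.2 ∂μ) - I2‖ ≤ η * k := h3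
  have a4 : K * ‖x (t + k) - xb - I1‖ ≤ K * (η * k) := by gcongr
  have : ε * k = (K + 3) * η * k := by rw [hηe]
  have : 0 < η * k := by positivity
  nlinarith

end Slide

namespace Slide
set_option linter.unusedSectionVars false
open Set Filter Topology

variable {E : Type*} [NormedAddCommGroup E] [NormedSpace ℝ E] [ProperSpace E]
variable {C : Type*} [TopologicalSpace C] [MeasurableSpace C] [BorelSpace C]
  [SecondCountableTopology C]
variable {Λ : Set C} {μ : Measure (ℝ × C)} {h : E → C → E}

theorem exists_flow (hh : Good Λ h) (hμ : Ctl Λ μ) {a b : ℝ} (hab : a ≤ b) :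
    ∃ X : E → ℝ → E, ∀ x0, Mot h μ a b (X x0) ∧ X x0 a = x0 := by
  choose X hX using fun x0 : E => exists_mot hh hμ hab x0
  exact ⟨X, hX⟩

theorem flow_lipB (hh : Good Λ h) (hμ : Ctl Λ μ) {a b : ℝ} {X : E → ℝ → E}
    (hX : ∀ x0, Mot h μ a b (X x0) ∧ X x0 a = x0) {τ : ℝ} (hτ : τ ∈ Icc a b) :
    LipB (fun x0 => X x0 τ) := by
  intro R
  obtain ⟨K, hK, hK'⟩ := hh.flow_lip R (b - a)
  refine ⟨K, hK, fun x y hx hy => ?_⟩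
  have := hK' μ hμ a b (X x) (X y) le_rfl (hX x).1 (hX y).1 (by rwa [(hX x).2])
    (by rwa [(hX y).2]) τ hτ
  rwa [(hX x).2, (hX y).2] at this

theorem Flow.lipB' {H : C → ℝ → E → E} (hH : Flow Λ h H) (hh : Good Λ h) {b : C} (hb : b ∈ Λ)
    {τ : ℝ} (hτ : 0 ≤ τ) : LipB (H b τ) := by
  intro R
  obtain ⟨K, hK, hK'⟩ := hH.lipB hh hb τ R
  exact ⟨K, hK, hK' τ ⟨hτ, le_rfl⟩⟩

section two
variable {C' : Type*} [TopologicalSpace C'] [MeasurableSpace C'] [BorelSpace C']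
  [SecondCountableTopology C'] {Λ' : Set C'} {h' : E → C' → E} {ρ : Measure (ℝ × C')}

theorem two_param (hh : Good Λ h) (hh' : Good Λ' h') {H : C → ℝ → E → E} {H' : C' → ℝ → E → E}
    (hH : Flow Λ h H) (hH' : Flow Λ' h' H')
    (hcomm : ∀ b ∈ Λ, ∀ b' ∈ Λ', ∀ τ τ', 0 ≤ τ → 0 ≤ τ' → ∀ x,
      H b τ (H' b' τ' x) = H' b' τ' (H b τ x))
    (hμ : Ctl Λ μ) {a b : ℝ} (hab : a ≤ b) {X : E → ℝ → E}
    (hX : ∀ x0, Mot h μ a b (X x0) ∧ X x0 a = x0)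
    (hρ : Ctl Λ' ρ) {c d : ℝ} {w : ℝ → E} (hw : Mot h' ρ c d w) {τ : ℝ} (hτ : τ ∈ Icc a b) :
    Mot h' ρ c d (fun r => X (w r) τ) := by
  refine push hh' hH' (flow_lipB hh hμ hX hτ) (fun b' hb' τ' hτ' x => ?_) hρ hw
  have h1 : Mot h μ a b (H' b' τ' ∘ X x) :=
    push hh hH (hH'.lipB' hh' hb' hτ')
      (fun b hb τ hτ y => (hcomm b hb b' hb' τ τ' hτ hτ' y).symm) hμ (hX x).1
  exact (hX _).1.unique hh hμ h1 (by rw [(hX _).2, Function.comp_apply, (hX x).2]) τ hτ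

end two

theorem flow_joint (hh : Good Λ h) (hμ : Ctl Λ μ) {a b : ℝ} (hab : a ≤ b) {X : E → ℝ → E}
    (hX : ∀ x0, Mot h μ a b (X x0) ∧ X x0 a = x0) {w : ℝ → E} (hw : Continuous w) :
    Continuous fun t => X (w t) (max a (min b t)) := by
  have hπ : ∀ t, max a (min b t) ∈ Icc a b := fun t =>
    ⟨le_max_left _ _, max_le hab (min_le_left _ _)⟩
  rw [continuous_iff_continuousAt]
  intro t0
  obtain ⟨K, hK, hK'⟩ := hh.flow_lip (‖w t0‖ + 1) (b - a)
  have hc : Continuous fun t => X (w t0) (max a (min b t)) := (hX (w t0)).1.cont.comp (by fun_prop)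
  have hlim : Tendsto (fun t => K * ‖w t - w t0‖ +
      ‖X (w t0) (max a (min b t)) - X (w t0) (max a (min b t0))‖) (𝓝 t0) (𝓝 0) := by
    have : Continuous (fun t => K * ‖w t - w t0‖ +
      ‖X (w t0) (max a (min b t)) - X (w t0) (max a (min b t0))‖) :=
      (continuous_const.mul (hw.sub continuous_const).norm).add (hc.sub continuous_const).norm
    have := this.tendsto t0
    simpa using this
  rw [ContinuousAt, tendsto_iff_norm_sub_tendsto_zero]
  refine squeeze_zero' (Eventually.of_forall fun _ => norm_nonneg _) ?_ hlim
  have hn : ∀ᶠ t in 𝓝 t0, ‖w t‖ < ‖w t0‖ + 1 :=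
    hw.norm.tendsto t0 |>.eventually (gt_mem_nhds (by linarith))
  filter_upwards [hn] with t ht
  have h1 := hK' μ hμ a b (X (w t)) (X (w t0)) le_rfl (hX _).1 (hX _).1
    (by rw [(hX _).2]; exact ht.le) (by rw [(hX _).2]; linarith) _ (hπ t)
  rw [(hX _).2, (hX _).2] at h1
  have h2 := norm_add_le (X (w t) (max a (min b t)) - X (w t0) (max a (min b t)))
    (X (w t0) (max a (min b t)) - X (w t0) (max a (min b t0)))
  rw [sub_add_sub_cancel] at h2
  linarith

/-- the diagonal of the two-parameter family is a motion of the sum -/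
theorem diagonal {h' : E → C → E} (hh : Good Λ h) (hh' : Good Λ h')
    (hs : Good Λ (fun x b => h x b + h' x b)) {H H' : C → ℝ → E → E}
    (hH : Flow Λ h H) (hH' : Flow Λ h' H')
    (hcomm : ∀ b ∈ Λ, ∀ b' ∈ Λ, ∀ τ τ', 0 ≤ τ → 0 ≤ τ' → ∀ x,
      H b τ (H' b' τ' x) = H' b' τ' (H b τ x))
    (hμ : Ctl Λ μ) {a b : ℝ} (hab : a ≤ b) {X : E → ℝ → E}
    (hX : ∀ x0, Mot h μ a b (X x0) ∧ X x0 a = x0)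
    {w y : ℝ → E} (hw : Mot h' μ a b w) (hy : Mot (fun x b => h x b + h' x b) μ a b y)
    (hwy : w a = y a) : ∀ s ∈ Icc a b, y s = X (w s) s := by
  have hπ : ∀ t ∈ Icc a b, max a (min b t) = t := fun t ht => by
    rw [min_eq_right ht.2, max_eq_right ht.1]
  have hYc := flow_joint hh hμ hab hX hw.cont
  set Y := fun t => X (w t) (max a (min b t)) with hY
  have hYe : ∀ t ∈ Icc a b, Y t = X (w t) t := fun t ht => by rw [hY]; simp only [hπ t ht]
  have hM : Mot (fun x b => h x b + h' x b) μ a b Y := by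
    refine Mot.of_local hs hμ hYc fun t ht ε hε => ?_
    have htI : t ∈ Icc a b := ⟨ht.1, ht.2.le⟩
    have hM2 := two_param hh hh' hH hH' hcomm hμ hab hX hμ hw htI
    obtain ⟨L, hL, hlip⟩ := hh.lip (‖Y t‖ + 1)
    obtain ⟨K, hK, hK'⟩ := hh.flow_lip (‖w t‖ + 1) (b - a)
    set δ := min 1 (ε / (3 * (L + 1))) with hδ
    have hδ0 : 0 < δ := by positivity
    have hδL : L * δ ≤ ε / 3 := by
      have : δ ≤ ε / (3 * (L + 1)) := min_le_right _ _
      have h2 : (L + 1) * (ε / (3 * (L + 1))) = ε / 3 := by field_simp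
      nlinarith
    obtain ⟨δ1, hδ1, hδ1'⟩ := Metric.continuous_iff.1 (hX (w t)).1.cont t (δ / 2) (by positivity)
    obtain ⟨δ2, hδ2, hδ2'⟩ := Metric.continuous_iff.1 hw.cont t (min 1 (δ / (2 * (K + 1))))
      (by positivity)
    filter_upwards [loc_int hs hμ hYc t (show 0 < ε / 3 by positivity),
      loc_int hh' hμ hM2.cont t (show 0 < ε / 3 by positivity),
      Ioo_mem_nhdsGT (show 0 < b - t by linarith [ht.2]), Ioo_mem_nhdsGT hδ1, Ioo_mem_nhdsGT hδ2]
      with k e1 e2 hkb hk1 hk2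
    have hk : 0 < k := hkb.1
    have htk : t + k ∈ Icc a b := ⟨by linarith [ht.1], by linarith [hkb.2]⟩
    have hwk := hδ2' (t + k) (by simpa [abs_of_pos hk] using hk2.2)
    rw [dist_eq_norm] at hwk
    have hwk1 : ‖w (t + k) - w t‖ ≤ 1 := (hwk.trans_le (min_le_left _ _)).le
    have hwk2 : K * ‖w (t + k) - w t‖ ≤ δ / 2 := by
      have h1 : ‖w (t + k) - w t‖ ≤ δ / (2 * (K + 1)) := (hwk.trans_le (min_le_right _ _)).le
      have h2 : (K + 1) * (δ / (2 * (K + 1))) = δ / 2 := by field_simp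
      nlinarith [norm_nonneg (w (t + k) - w t)]
    have hwn : ‖w (t + k)‖ ≤ ‖w t‖ + 1 := by
      have := norm_add_le (w t) (w (t + k) - w t)
      rw [add_sub_cancel] at this
      linarith
    -- integral of the first field
    have i1 := hh.integrableOn hμ (hX (w (t + k))).1.cont t (t + k)
    have i2 := hh.integrableOn hμ (x := fun _ => Y t) continuous_const t (t + k)
    have i3 := hh'.integrableOn hμ (x := fun _ => Y t) continuous_const t (t + k)
    have d1 : ‖(∫ z in strip C t (t + k), h (X (w (t + k)) z.1) z.2 ∂μ) -
        ∫ z in strip C t (t + k), h (Y t) z.2 ∂μ‖ ≤ ε / 3 * k := by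
      rw [← integral_sub i1 i2]
      have := hμ.norm_int_le_const (show t ≤ t + k by linarith) (show 0 ≤ ε / 3 by positivity)
        (G := fun z => h (X (w (t + k)) z.1) z.2 - h (Y t) z.2) (fun z h1 h2 => by
          have hz : z.1 ∈ Icc a b := ⟨by linarith [ht.1, h1.1], by linarith [h1.2, htk.2]⟩
          have h3 := hK' μ hμ a b (X (w (t + k))) (X (w t)) le_rfl (hX _).1 (hX _).1
            (by rw [(hX _).2]; exact hwn) (by rw [(hX _).2]; linarith) z.1 hz
          rw [(hX _).2, (hX _).2] at h3
          have h4 := hδ1' z.1 (by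
            rw [Real.dist_eq, abs_of_pos (by linarith [h1.1])]; linarith [h1.2, hk1.2])
          rw [dist_eq_norm, ← hYe t htI] at h4
          have h5 := norm_add_le (X (w (t + k)) z.1 - X (w t) z.1) (X (w t) z.1 - Y t)
          rw [sub_add_sub_cancel] at h5
          have h6 : ‖X (w (t + k)) z.1 - Y t‖ ≤ δ := by linarith
          have h7 : δ ≤ 1 := min_le_left _ _
          have h8 := norm_add_le (Y t) (X (w (t + k)) z.1 - Y t)
          rw [add_sub_cancel] at h8
          refine (hlip _ h2 _ _ (by linarith) (by linarith)).trans ?_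
          nlinarith)
      simpa using this
    rw [← (hX (w (t + k))).1.inc t (t + k) ht.1 (by linarith) htk.2] at d1
    rw [← hM2.inc t (t + k) ht.1 (by linarith) htk.2, ← hYe t htI] at e2
    have e3 : ∫ z in strip C t (t + k), h (Y t) z.2 + h' (Y t) z.2 ∂μ =
      ∫ z in strip C t (t + k), h (Y t) z.2 ∂μ + ∫ z in strip C t (t + k), h' (Y t) z.2 ∂μ :=
      integral_add i2 i3
    rw [e3] at e1
    rw [hYe (t + k) htk]
    set I1 := ∫ z in strip C t (t + k), h (Y t) z.2 ∂μ
    set I2 := ∫ z in strip C t (t + k), h' (Y t) z.2 ∂μ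
    set I3 := ∫ z in strip C t (t + k), h (Y z.1) z.2 + h' (Y z.1) z.2 ∂μ
    have e4 : X (w (t + k)) (t + k) - Y t - I3 =
      (X (w (t + k)) (t + k) - X (w (t + k)) t - I1) + (X (w (t + k)) t - Y t - I2)
       - (I3 - (I1 + I2)) := by abel
    rw [e4]
    have n1 := norm_sub_le ((X (w (t + k)) (t + k) - X (w (t + k)) t - I1) +
      (X (w (t + k)) t - Y t - I2)) (I3 - (I1 + I2))
    have n2 := norm_add_le (X (w (t + k)) (t + k) - X (w (t + k)) t - I1)
      (X (w (t + k)) t - Y t - I2)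
    linarith
  intro s hsI
  rw [← hYe s hsI]
  have haI : a ∈ Icc a b := ⟨le_rfl, hab⟩
  exact hy.unique hs hμ hM (by rw [hYe a haI, (hX _).2, hwy]) s hsI

end Slide

namespace Slide
set_option linter.unusedSectionVars false
open Set Filter Topology

variable {E : Type*} [NormedAddCommGroup E] [NormedSpace ℝ E] [ProperSpace E]
variable {C : Type*} [TopologicalSpace C] [MeasurableSpace C] [BorelSpace C]
  [SecondCountableTopology C]
variable {Λ : Set C} {μ : Measure (ℝ × C)} {h : E → C → E}

/-- full controls on `(a,b]` -/
def FC (Λ : Set C) (a b : ℝ) (μ : Measure (ℝ × C)) : Prop :=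
  μ.map Prod.fst = volume.restrict (Ioc a b) ∧ ∀ᵐ z ∂μ, z.2 ∈ Λ

/-- trajectories on `[a,b]` -/
def Tr (Λ : Set C) (h : E → C → E) (a b : ℝ) (x : ℝ → E) : Prop :=
  ∃ μ, FC Λ a b μ ∧ Mot h μ a b x

theorem FC.ctl {a b : ℝ} (hμ : FC Λ a b μ) : Ctl Λ μ :=
  ⟨hμ.1 ▸ Measure.restrict_le_self, hμ.2⟩

theorem map_fst_restrict (μ : Measure (ℝ × C)) (s t : ℝ) :
    (μ.restrict (strip C s t)).map Prod.fst = (μ.map Prod.fst).restrict (Ioc s t) :=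
  (Measure.restrict_map measurable_fst measurableSet_Ioc).symm

theorem FC.restrict {a b a' b' : ℝ} (hμ : FC Λ a b μ) (h1 : a ≤ a') (h2 : b' ≤ b) :
    FC Λ a' b' (μ.restrict (strip C a' b')) := by
  refine ⟨?_, ae_restrict_of_ae hμ.2⟩
  rw [map_fst_restrict, hμ.1, Measure.restrict_restrict measurableSet_Ioc,
    inter_eq_left.2 (Ioc_subset_Ioc h1 h2)]

theorem restrict_strip_idem (μ : Measure (ℝ × C)) (s t : ℝ) :
    (μ.restrict (strip C s t)).restrict (strip C s t) = μ.restrict (strip C s t) := by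
  rw [Measure.restrict_restrict (measurableSet_strip s t), inter_self]

theorem Mot.restrict {a b : ℝ} {x : ℝ → E} (hx : Mot h μ a b x) :
    Mot h (μ.restrict (strip C a b)) a b x :=
  hx.congr hx.cont (fun _ _ => rfl) (restrict_strip_idem _ _ _)

theorem Tr.cont {a b : ℝ} {x : ℝ → E} (hx : Tr Λ h a b x) : Continuous x := by
  obtain ⟨μ, _, h⟩ := hx
  exact h.cont

theorem Tr.mono {a b a' b' : ℝ} {x : ℝ → E} (hx : Tr Λ h a b x) (h1 : a ≤ a') (h2 : b' ≤ b) :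
    Tr Λ h a' b' x := by
  obtain ⟨μ, hμ, hm⟩ := hx
  exact ⟨_, hμ.restrict h1 h2, (hm.mono h1 h2).restrict⟩

theorem Tr.congr {a b : ℝ} {x x' : ℝ → E} (hx : Tr Λ h a b x) (hx' : Continuous x')
    (heq : ∀ t ∈ Icc a b, x' t = x t) : Tr Λ h a b x' := by
  obtain ⟨μ, hμ, hm⟩ := hx
  exact ⟨μ, hμ, hm.congr hx' heq rfl⟩

theorem FC.strip_zero {a b s t : ℝ} (hμ : FC Λ a b μ) (hd : Disjoint (Ioc s t) (Ioc a b)) :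
    μ.restrict (strip C s t) = 0 := by
  rw [Measure.restrict_eq_zero, strip, ← Measure.map_apply measurable_fst measurableSet_Ioc, hμ.1,
    Measure.restrict_apply measurableSet_Ioc, hd.inter_eq, measure_empty]

theorem Tr.concat (hh : Good Λ h) {a b c : ℝ} {x y : ℝ → E} (hac : a ≤ c) (hcb : c ≤ b)
    (hx : Tr Λ h a c x)
    (hy : Tr Λ h c b y) (hxy : x c = y c) : Tr Λ h a b (glue x y c) := by
  obtain ⟨μ, hμ, hm⟩ := hx
  obtain ⟨μ', hμ', hm'⟩ := hy
  have hF : FC Λ a b (μ + μ') := by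
    refine ⟨?_, ?_⟩
    · rw [Measure.map_add _ _ measurable_fst, hμ.1, hμ'.1, ← Ioc_union_Ioc_eq_Ioc hac hcb,
        Measure.restrict_union (Ioc_disjoint_Ioc_of_le le_rfl) measurableSet_Ioc]
    · rw [ae_add_measure_iff]; exact ⟨hμ.2, hμ'.2⟩
  have e1 : (μ + μ').restrict (strip C a c) = μ.restrict (strip C a c) := by
    rw [Measure.restrict_add, hμ'.strip_zero (Ioc_disjoint_Ioc_of_le le_rfl), add_zero]
  have e2 : (μ + μ').restrict (strip C c b) = μ'.restrict (strip C c b) := by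
    rw [Measure.restrict_add, hμ.strip_zero (Ioc_disjoint_Ioc_of_le le_rfl).symm, zero_add]
  exact ⟨_, hF, Mot.glue hh hF.ctl (hm.congr hm.cont (fun _ _ => rfl) e1)
    (hm'.congr hm'.cont (fun _ _ => rfl) e2) hxy⟩

theorem Tr.shift (hh : Good Λ h) {a b : ℝ} {x : ℝ → E} (hx : Tr Λ h a b x) (s : ℝ) :
    Tr Λ h (a + s) (b + s) (fun t => x (t - s)) := by
  obtain ⟨μ, hμ, hm⟩ := hx
  have hmeas : Measurable (fun z : ℝ × C => (z.1 + s, z.2)) := by fun_prop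
  have hxc : Continuous (fun t => x (t - s)) := hm.cont.comp (by fun_prop)
  refine ⟨μ.map (fun z => (z.1 + s, z.2)), ⟨?_, ?_⟩, hxc, ?_⟩
  · rw [Measure.map_map measurable_fst hmeas]
    have : (Prod.fst ∘ fun z : ℝ × C => (z.1 + s, z.2)) = (fun r => r + s) ∘ Prod.fst := rfl
    rw [this, ← Measure.map_map (by fun_prop) measurable_fst, hμ.1]
    have h2 : Ioc a b = (fun r => r + s) ⁻¹' Ioc (a + s) (b + s) := by
      ext r; simp
    rw [h2, ← Measure.restrict_map (by fun_prop) measurableSet_Ioc, map_add_right_eq_self]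
  · rw [ae_map_iff hmeas.aemeasurable (measurable_snd hh.mset)]
    exact hμ.2
  · intro r t h1 h2 h3
    rw [hm.inc (r - s) (t - s) (by linarith) (by linarith) (by linarith),
      setIntegral_map (measurableSet_strip r t) (hh.meas hxc _) hmeas.aemeasurable]
    have : (fun z : ℝ × C => (z.1 + s, z.2)) ⁻¹' strip C r t = strip C (r - s) (t - s) := by
      ext z; simp [strip, sub_lt_iff_lt_add, le_sub_iff_add_le]
    rw [this]
    simp

theorem Flow.tr {H : C → ℝ → E → E} (hH : Flow Λ h H) (hh : Good Λ h) {c : C} (hc : c ∈ Λ)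
    (t1 : ℝ) (x : E) (a b : ℝ) : Tr Λ h a b fun t => H c (t - t1) x := by
  refine ⟨_, ⟨?_, ae_restrict_of_ae (cc_ae hh.mset hc)⟩, (hH.mot hh hc t1 x a b).restrict⟩
  rw [map_fst_restrict, cc_fst]

section emb
variable {C' : Type*} [TopologicalSpace C'] [MeasurableSpace C'] [BorelSpace C']
  [SecondCountableTopology C'] {Λ' : Set C'} {h' : E → C' → E}

theorem Tr.map (hh' : Good Λ' h') {π : C → C'} (hπ : Measurable π) (hπΛ : ∀ c ∈ Λ, π c ∈ Λ')
    (he : ∀ c ∈ Λ, ∀ x, h' x (π c) = h x c) {a b : ℝ} {x : ℝ → E} (hx : Tr Λ h a b x) :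
    Tr Λ' h' a b x := by
  obtain ⟨μ, hμ, hm⟩ := hx
  have hmeas : Measurable (fun z : ℝ × C => (z.1, π z.2)) := by fun_prop
  refine ⟨μ.map (fun z => (z.1, π z.2)), ⟨?_, ?_⟩, hm.cont, ?_⟩
  · rw [Measure.map_map measurable_fst hmeas]
    exact hμ.1
  · rw [ae_map_iff hmeas.aemeasurable (measurable_snd hh'.mset)]
    filter_upwards [hμ.2] with z hz using hπΛ _ hz
  · intro r t h1 h2 h3
    rw [hm.inc r t h1 h2 h3,
      setIntegral_map (measurableSet_strip r t) (hh'.meas hm.cont _) hmeas.aemeasurable]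
    have : (fun z : ℝ × C => (z.1, π z.2)) ⁻¹' strip C' r t = strip C r t := rfl
    rw [this]
    refine integral_congr_ae ?_
    filter_upwards [ae_restrict_of_ae hμ.2] with z hz
    exact (he _ hz _).symm

/-- Lemma A' -/
theorem lemmaA (hh : Good Λ h) (hh' : Good Λ' h') {H : C → ℝ → E → E} {H' : C' → ℝ → E → E}
    (hH : Flow Λ h H) (hH' : Flow Λ' h' H')
    (hcomm : ∀ b ∈ Λ, ∀ b' ∈ Λ', ∀ τ τ', 0 ≤ τ → 0 ≤ τ' → ∀ x,
      H b τ (H' b' τ' x) = H' b' τ' (H b τ x)) {a b c d : ℝ} (hab : a ≤ b)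
    {z w : ℝ → E} (hz : Tr Λ h a b z) (hw : Tr Λ' h' c d w) (hzw : z a = w d) :
    ∃ z', Tr Λ h a b z' ∧ z' a = w c ∧ ∀ τ ∈ Icc a b, ∃ w', Tr Λ' h' c d w' ∧ w' c = z' τ ∧
      w' d = z τ := by
  obtain ⟨μ, hμ, hm⟩ := hz
  obtain ⟨ρ, hρ, hwm⟩ := hw
  obtain ⟨X, hX⟩ := exists_flow hh hμ.ctl hab
  refine ⟨X (w c), ⟨μ, hμ, (hX _).1⟩, (hX _).2, fun τ hτ => ?_⟩
  refine ⟨fun r => X (w r) τ, ⟨ρ, hρ, two_param hh hh' hH hH' hcomm hμ.ctl hab hX hρ.ctl hwm hτ⟩,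
    rfl, ?_⟩
  exact (hX _).1.unique hh hμ.ctl hm (by rw [(hX _).2, hzw]) τ hτ

end emb

end Slide

namespace Slide
set_option linter.unusedSectionVars false
open Set Filter Topology

variable {E : Type*} [NormedAddCommGroup E] [NormedSpace ℝ E] [ProperSpace E]
variable {C : Type*} [TopologicalSpace C] [MeasurableSpace C] [BorelSpace C]
  [SecondCountableTopology C]
variable {Λ : Set C} {μ : Measure (ℝ × C)} {h : E → C → E}

/-- maximal generalized inverse of a monotone continuous function -/
theorem gen_inv {θ : ℝ → ℝ} (hθ : Continuous θ) (hmono : Monotone θ) {a b : ℝ} (hab : a ≤ b) :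
    ∃ R : ℝ → ℝ, ∀ τ, θ a ≤ τ → R τ ∈ Icc a b ∧ (∀ t ∈ Icc a b, θ t ≤ τ ↔ t ≤ R τ) ∧
      (τ ≤ θ b → θ (R τ) = τ) ∧ (θ b ≤ τ → R τ = b) := by
  refine ⟨fun τ => sSup (Icc a b ∩ θ ⁻¹' Iic τ), fun τ hτ => ?_⟩
  have hcomp : IsCompact (Icc a b ∩ θ ⁻¹' Iic τ) :=
    isCompact_Icc.inter_right (isClosed_Iic.preimage hθ)
  have hne : (Icc a b ∩ θ ⁻¹' Iic τ).Nonempty := ⟨a, ⟨le_rfl, hab⟩, hτ⟩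
  have hmem := hcomp.sSup_mem hne
  have hle : ∀ t ∈ Icc a b, θ t ≤ τ → t ≤ sSup (Icc a b ∩ θ ⁻¹' Iic τ) := fun t ht h =>
    le_csSup hcomp.bddAbove ⟨ht, h⟩
  refine ⟨hmem.1, fun t ht => ⟨hle t ht, fun h => (hmono h).trans hmem.2⟩, fun h => ?_, fun h => ?_⟩
  · obtain ⟨r, hr, hr'⟩ := intermediate_value_Icc hab hθ.continuousOn ⟨hτ, h⟩
    refine le_antisymm hmem.2 ?_
    have := hmono (hle r hr hr'.le)
    rwa [hr'] at this
  · exact le_antisymm hmem.1.2 (hle b ⟨hab, le_rfl⟩ h)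

/-- mass over the strip -/
theorem mass_add (hμ : Ctl Λ μ) {s r t : ℝ} (h1 : s ≤ r) (h2 : r ≤ t) :
    μ.real (strip C s t) = μ.real (strip C s r) + μ.real (strip C r t) := by
  rw [strip_union h1 h2]
  exact measureReal_union (Disjoint.preimage _ (Ioc_disjoint_Ioc_of_le le_rfl))
    (measurableSet_strip _ _) (hμ.strip_lt _ _).ne (hμ.strip_lt _ _).ne

theorem mass_self (a : ℝ) : μ.real (strip C a a) = 0 := by simp [strip]

/-- clamped cumulative mass -/
theorem mass_props (hμ : Ctl Λ μ) {a b : ℝ} (hab : a ≤ b) (c : ℝ) :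
    let θ := fun r => c + μ.real (strip C a (max a (min b r)))
    Continuous θ ∧ Monotone θ ∧ θ a = c ∧ ∀ r ∈ Icc a b, θ r = c + μ.real (strip C a r) := by
  intro θ
  have hmono : Monotone θ := by
    intro r t hrt
    have h1 : max a (min b r) ≤ max a (min b t) := max_le_max le_rfl (min_le_min le_rfl hrt)
    have := mass_add hμ (le_max_left a (min b r)) h1
    have h3 : 0 ≤ μ.real (strip C (max a (min b r)) (max a (min b t))) := measureReal_nonneg
    simp only [θ]
    linarith
  have hval : ∀ r ∈ Icc a b, θ r = c + μ.real (strip C a r) := fun r hr => by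
    simp only [θ]
    rw [min_eq_right hr.2, max_eq_right hr.1]
  refine ⟨?_, hmono, ?_, hval⟩
  · have hlip : LipschitzWith 1 θ := by
      apply LipschitzWith.of_le_add
      intro r t
      rcases le_total r t with h | h
      · exact (hmono h).trans (by linarith [dist_nonneg (x := r) (y := t)])
      · have h1 : max a (min b t) ≤ max a (min b r) := max_le_max le_rfl (min_le_min le_rfl h)
        have h2 := mass_add hμ (le_max_left a (min b t)) h1
        have h3 := hμ.real_le h1
        have h4 : max a (min b r) - max a (min b t) ≤ r - t := by
          rcases le_total a (min b r) with h5 | h5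
          · rw [max_eq_right h5]
            rcases le_total b t with h6 | h6
            · rw [min_eq_left h6]
              have := le_max_right a b
              have := min_le_left b r
              linarith
            · rw [min_eq_right h6]
              have := le_max_right a t
              have := min_le_right b r
              linarith
          · rw [max_eq_left h5]
            have := le_max_left a (min b t)
            linarith
        rw [Real.dist_eq, abs_of_nonneg (by linarith)]
        simp only [θ]
        linarith
    exact hlip.continuous
  · rw [hval a ⟨le_rfl, hab⟩, mass_self, add_zero]

theorem time_change (hh : Good Λ h) (hμ : Ctl Λ μ) {a b : ℝ} (hab : a ≤ b) {γ : ℝ → E}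
    (hγ : Mot h μ a b γ) (c : ℝ) :
    ∃ γ', Tr Λ h c (c + μ.real (strip C a b)) γ' ∧
      ∀ r ∈ Icc a b, γ' (c + μ.real (strip C a r)) = γ r := by
  obtain ⟨hθc, hθm, hθa, hθv⟩ := mass_props hμ hab c
  set θ := fun r => c + μ.real (strip C a (max a (min b r))) with hθdef
  obtain ⟨R, hR⟩ := gen_inv hθc hθm hab
  rw [hθa] at hR
  have hbI : b ∈ Icc a b := ⟨hab, le_rfl⟩
  rw [← hθv b hbI]
  set d := θ b with hd
  have hcd : c ≤ d := by rw [← hθa]; exact hθm hab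
  -- bound of increments by mass
  obtain ⟨cg, hcg, hg⟩ := hh.grow
  obtain ⟨B0, hB0, hB0'⟩ := exists_bound hγ.cont a b
  have hinc0 : ∀ s ∈ Icc a b, ∀ t ∈ Icc a b, s ≤ t →
      ‖γ t - γ s‖ ≤ cg * (1 + B0) * (θ t - θ s) := by
    intro s hs t ht hst
    rw [hγ.inc s t hs.1 hst ht.2]
    have h1 : ‖∫ z in strip C s t, h (γ z.1) z.2 ∂μ‖ ≤
        cg * (1 + B0) * μ.real (strip C s t) := by
      refine norm_setIntegral_le_of_norm_le_const_ae (hμ.strip_lt s t) ?_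
      filter_upwards [hμ.ae_restrict s t] with z hz
      refine (hg _ hz.2 _).trans ?_
      have := hB0' z.1 ⟨by linarith [hs.1, hz.1.1], by linarith [ht.2, hz.1.2]⟩
      gcongr
    have h2 := mass_add hμ hs.1 hst
    rw [hθv s hs, hθv t ht]
    convert h1 using 2
    linarith
  have hinc : ∀ s ∈ Icc a b, ∀ t ∈ Icc a b, ‖γ t - γ s‖ ≤ cg * (1 + B0) * |θ t - θ s| := by
    intro s hs t ht
    rcases le_total s t with h | h
    · refine (hinc0 s hs t ht h).trans ?_
      gcongr
      exact le_abs_self _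
    · rw [norm_sub_rev, abs_sub_comm]
      refine (hinc0 t ht s hs h).trans ?_
      gcongr
      exact le_abs_self _
  set cl := fun τ => max c (min d τ) with hcl
  have hclI : ∀ τ, cl τ ∈ Icc c d := fun τ => ⟨le_max_left _ _, max_le hcd (min_le_left _ _)⟩
  have hclid : ∀ τ ∈ Icc c d, cl τ = τ := fun τ h => by
    simp only [hcl]; rw [min_eq_right h.2, max_eq_right h.1]
  have hclc : Continuous cl := by fun_prop
  set γ' := fun τ => γ (R (cl τ)) with hγ'
  have hγ'c : Continuous γ' := by
    rw [continuous_iff_continuousAt]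
    intro τ0
    rw [ContinuousAt, tendsto_iff_norm_sub_tendsto_zero]
    have hlim : Tendsto (fun τ => cg * (1 + B0) * |cl τ - cl τ0|) (𝓝 τ0) (𝓝 0) := by
      have : Continuous (fun τ => cg * (1 + B0) * |cl τ - cl τ0|) := by fun_prop
      simpa using this.tendsto τ0
    refine squeeze_zero (fun _ => norm_nonneg _) (fun τ => ?_) hlim
    obtain ⟨p1, -, p3, -⟩ := hR (cl τ) (hclI τ).1
    obtain ⟨q1, -, q3, -⟩ := hR (cl τ0) (hclI τ0).1
    have := hinc _ q1 _ p1
    rwa [p3 (hclI τ).2, q3 (hclI τ0).2] at this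
  have hθI : ∀ r ∈ Icc a b, θ r ∈ Icc c d := fun r hr =>
    ⟨by rw [← hθa]; exact hθm hr.1, hθm hr.2⟩
  have hval : ∀ r ∈ Icc a b, γ' (θ r) = γ r := by
    intro r hr
    simp only [hγ', hclid _ (hθI r hr)]
    obtain ⟨p1, -, p3, -⟩ := hR (θ r) (hθI r hr).1
    have := hinc _ hr _ p1
    rw [p3 (hθI r hr).2, sub_self, abs_zero, mul_zero] at this
    exact sub_eq_zero.1 (norm_le_zero_iff.1 this)
  refine ⟨γ', ⟨(μ.restrict (strip C a b)).map (fun z => (θ z.1, z.2)), ⟨?_, ?_⟩, hγ'c, ?_⟩,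
    fun r hr => by rw [← hθv r hr]; exact hval r hr⟩
  · have hmeas : Measurable (fun z : ℝ × C => (θ z.1, z.2)) := by
      have := hθc.measurable
      fun_prop
    have hfin : IsFiniteMeasure (μ.restrict (strip C a b)) :=
      ⟨by rw [Measure.restrict_apply_univ]; exact hμ.strip_lt a b⟩
    rw [Measure.map_map measurable_fst hmeas]
    have hfm : Measurable (Prod.fst ∘ fun z : ℝ × C => (θ z.1, z.2)) := measurable_fst.comp hmeas
    have hfin2 : IsFiniteMeasure ((μ.restrict (strip C a b)).map
      (Prod.fst ∘ fun z : ℝ × C => (θ z.1, z.2))) := Measure.isFiniteMeasure_map _ _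
    refine Measure.ext_of_Iic _ _ fun τ => ?_
    rw [Measure.map_apply hfm measurableSet_Iic, Measure.restrict_apply (hfm measurableSet_Iic),
      Measure.restrict_apply measurableSet_Iic]
    rcases lt_or_ge τ c with hτ | hτ
    · have e1 : (Prod.fst ∘ fun z : ℝ × C => (θ z.1, z.2)) ⁻¹' Iic τ ∩ strip C a b = ∅ := by
        ext z
        simp only [mem_inter_iff, mem_preimage, Function.comp_apply, mem_Iic, mem_empty_iff_false,
          iff_false, not_and]
        intro h1 h2
        have := (hθI z.1 ⟨h2.1.le, h2.2⟩).1
        linarith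
      have e2 : Iic τ ∩ Ioc c d = ∅ := by
        ext r
        simp only [mem_inter_iff, mem_Iic, mem_Ioc, mem_empty_iff_false, iff_false, not_and]
        intro h1 h2
        linarith
      rw [e1, e2, measure_empty, measure_empty]
    · obtain ⟨p1, p2, p3, p4⟩ := hR τ hτ
      have e1 : (Prod.fst ∘ fun z : ℝ × C => (θ z.1, z.2)) ⁻¹' Iic τ ∩ strip C a b =
          strip C a (R τ) := by
        ext z
        simp only [mem_inter_iff, mem_preimage, Function.comp_apply, mem_Iic, strip, mem_Ioc]
        constructor
        · rintro ⟨h1, h2⟩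
          exact ⟨h2.1, (p2 _ ⟨h2.1.le, h2.2⟩).1 h1⟩
        · rintro ⟨h1, h2⟩
          exact ⟨(p2 _ ⟨h1.le, h2.trans p1.2⟩).2 h2, h1, h2.trans p1.2⟩
      have e2 : Iic τ ∩ Ioc c d = Ioc c (min d τ) := by
        ext r
        simp only [mem_inter_iff, mem_Iic, mem_Ioc, le_min_iff]
        tauto
      have e3 : θ (R τ) = min d τ := by
        rcases le_total τ d with h | h
        · rw [p3 h, min_eq_right h]
        · rw [p4 h, min_eq_left h]
      rw [e1, e2, Real.volume_Ioc, ← e3, hθv _ p1, add_sub_cancel_left,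
        ofReal_measureReal (hμ.strip_lt _ _).ne]
  · have hmeas : Measurable (fun z : ℝ × C => (θ z.1, z.2)) := by
      have := hθc.measurable
      fun_prop
    rw [ae_map_iff hmeas.aemeasurable (measurable_snd hh.mset)]
    exact ae_restrict_of_ae hμ.2
  · intro σ τ h1 h2 h3
    have hmeas : Measurable (fun z : ℝ × C => (θ z.1, z.2)) := by
      have := hθc.measurable
      fun_prop
    have hσI : σ ∈ Icc c d := ⟨h1, h2.trans h3⟩
    have hτI : τ ∈ Icc c d := ⟨h1.trans h2, h3⟩
    obtain ⟨p1, p2, p3, p4⟩ := hR τ hτI.1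
    obtain ⟨q1, q2, q3, q4⟩ := hR σ hσI.1
    have hle : R σ ≤ R τ := (p2 _ q1).1 (by rw [q3 hσI.2]; exact h2)
    rw [setIntegral_map (measurableSet_strip σ τ) (hh.meas hγ'c _) hmeas.aemeasurable,
      Measure.restrict_restrict (hmeas (measurableSet_strip σ τ))]
    have e1 : (fun z : ℝ × C => (θ z.1, z.2)) ⁻¹' strip C σ τ ∩ strip C a b =
        strip C (R σ) (R τ) := by
      ext z
      simp only [mem_inter_iff, mem_preimage, strip, mem_Ioc]
      constructor
      · rintro ⟨⟨h4, h5⟩, h6⟩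
        have hz : z.1 ∈ Icc a b := ⟨h6.1.le, h6.2⟩
        exact ⟨lt_of_not_ge fun h => absurd ((q2 _ hz).2 h) (not_le.2 h4), (p2 _ hz).1 h5⟩
      · rintro ⟨h4, h5⟩
        have hz : z.1 ∈ Icc a b := ⟨q1.1.trans h4.le, h5.trans p1.2⟩
        exact ⟨⟨lt_of_not_ge fun h => absurd ((q2 _ hz).1 h) (not_le.2 h4), (p2 _ hz).2 h5⟩,
          lt_of_le_of_lt q1.1 h4, hz.2⟩
    rw [e1]
    have e2 : γ' τ - γ' σ = γ (R τ) - γ (R σ) := by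
      simp only [hγ', hclid _ hσI, hclid _ hτI]
    rw [e2, hγ.inc _ _ q1.1 hle p1.2]
    refine setIntegral_congr_fun (measurableSet_strip _ _) fun z hz => ?_
    have hz : z.1 ∈ Ioc (R σ) (R τ) := hz
    simp only [hval z.1 ⟨q1.1.trans hz.1.le, hz.2.trans p1.2⟩]

end Slide

namespace Slide
set_option linter.unusedSectionVars false
open Set Filter Topology

variable {E : Type*} [NormedAddCommGroup E] [NormedSpace ℝ E] [ProperSpace E]
variable {C : Type*} [TopologicalSpace C] [MeasurableSpace C] [BorelSpace C]
  [SecondCountableTopology C]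
variable {Λ : Set C} {μ : Measure (ℝ × C)} {h : E → C → E}

section star
variable {C1 : Type*} [TopologicalSpace C1] [MeasurableSpace C1] [BorelSpace C1]
  [SecondCountableTopology C1] {Λ1 : Set C1} {f : E → C1 → E} {H1 : C1 → ℝ → E → E}
variable {C2 : Type*} [TopologicalSpace C2] [MeasurableSpace C2] [BorelSpace C2]
  [SecondCountableTopology C2] {Λ2 : Set C2} {g : E → C2 → E} {H2 : C2 → ℝ → E → E}

theorem select (hf : Good Λ1 f) (hh : Good Λ h) (hμ : Ctl Λ μ) {K : Set C} (hK : MeasurableSet K)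
    {π : C → C1} (hπ : Measurable π) (hπΛ : ∀ c ∈ Λ, π c ∈ Λ1)
    (h1 : ∀ c ∈ Λ, c ∈ K → ∀ x, h x c = f x (π c)) (h0 : ∀ c ∈ Λ, c ∉ K → ∀ x, h x c = 0)
    {a b : ℝ} (hab : a ≤ b) {γ : ℝ → E} (hγ : Mot h μ a b γ) (c : ℝ) :
    ∃ γ', Tr Λ1 f c (c + μ.real (strip C a b ∩ Prod.snd ⁻¹' K)) γ' ∧
      ∀ r ∈ Icc a b, γ' (c + μ.real (strip C a r ∩ Prod.snd ⁻¹' K)) = γ r := by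
  have hK' : MeasurableSet (Prod.snd ⁻¹' K : Set (ℝ × C)) := measurable_snd hK
  have hmeas : Measurable (fun z : ℝ × C => (z.1, π z.2)) := by fun_prop
  set lam := (μ.restrict (Prod.snd ⁻¹' K)).map (fun z => (z.1, π z.2)) with hlam
  have hC : Ctl Λ1 lam := by
    constructor
    · rw [hlam, Measure.map_map measurable_fst hmeas]
      exact (Measure.map_mono Measure.restrict_le_self measurable_fst).trans hμ.1
    · rw [hlam, ae_map_iff hmeas.aemeasurable (measurable_snd hf.mset)]
      filter_upwards [ae_restrict_of_ae hμ.2] with z hz using hπΛ _ hz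
  have hpre : ∀ s t, (fun z : ℝ × C => (z.1, π z.2)) ⁻¹' strip C1 s t = strip C s t :=
    fun _ _ => rfl
  have hmass : ∀ s t, lam.real (strip C1 s t) = μ.real (strip C s t ∩ Prod.snd ⁻¹' K) := by
    intro s t
    rw [measureReal_def, measureReal_def, hlam, Measure.map_apply hmeas (measurableSet_strip _ _),
      hpre, Measure.restrict_apply (measurableSet_strip _ _)]
  have hM : Mot f lam a b γ := by
    refine ⟨hγ.cont, fun s t hs hst ht => ?_⟩
    rw [hγ.inc s t hs hst ht, hlam, setIntegral_map (measurableSet_strip s t)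
      (hf.meas hγ.cont _) hmeas.aemeasurable, hpre,
      Measure.restrict_restrict (measurableSet_strip s t), inter_comm,
      ← Measure.restrict_restrict hK', ← integral_indicator hK']
    refine integral_congr_ae ?_
    filter_upwards [ae_restrict_of_ae hμ.2] with z hz
    by_cases hzK : z.2 ∈ K
    · rw [indicator_of_mem (show z ∈ Prod.snd ⁻¹' K from hzK), h1 _ hz hzK]
    · rw [indicator_of_notMem (show z ∉ Prod.snd ⁻¹' K from hzK), h0 _ hz hzK]
  have := time_change hf hC hab hM c
  simpa only [hmass] using this

/-- star control set -/
abbrev LS (Λ1 : Set C1) (Λ2 : Set C2) : Set (ℝ × C1 × C2) := ({0, 1} : Set ℝ) ×ˢ Λ1 ×ˢ Λ2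

abbrev hS1 (C2 : Type*) (f : E → C1 → E) : E → ℝ × C1 × C2 → E := fun x c => c.1 • f x c.2.1
abbrev hS2 (C1 : Type*) (g : E → C2 → E) : E → ℝ × C1 × C2 → E := fun x c => (1 - c.1) • g x c.2.2

theorem LS_meas (hf : Good Λ1 f) (hg : Good Λ2 g) : MeasurableSet (LS Λ1 Λ2) :=
  MeasurableSet.prod (by measurability) (hf.mset.prod hg.mset)

theorem nu_abs {ν : ℝ} (hν : ν ∈ ({0, 1} : Set ℝ)) : |ν| ≤ 1 ∧ |1 - ν| ≤ 1 ∧ 0 ≤ ν ∧ 0 ≤ 1 - ν := by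
  rcases hν with rfl | rfl <;> norm_num

theorem good1 (hf : Good Λ1 f) (hg : Good Λ2 g) : Good (LS Λ1 Λ2) (hS1 C2 f) := by
  refine ⟨LS_meas hf hg, ?_, fun R => ?_, ?_⟩
  · have : Continuous fun z : E × ℝ × C1 × C2 => f z.1 z.2.2.1 :=
      hf.cont.comp (f := fun z : E × ℝ × C1 × C2 => (z.1, z.2.2.1)) (by fun_prop)
    exact Continuous.smul (by fun_prop) this
  · obtain ⟨L, hL, h⟩ := hf.lip R
    refine ⟨L, hL, fun b hb x y hx hy => ?_⟩
    have h1 := h b.2.1 hb.2.1 x y hx hy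
    have h2 := (nu_abs hb.1).1
    simp only [hS1]
    rw [← smul_sub, norm_smul, Real.norm_eq_abs]
    nlinarith [norm_nonneg (f x b.2.1 - f y b.2.1)]
  · obtain ⟨L, hL, h⟩ := hf.grow
    refine ⟨L, hL, fun b hb x => ?_⟩
    have h1 := h b.2.1 hb.2.1 x
    have h2 := (nu_abs hb.1).1
    simp only [hS1]
    rw [norm_smul, Real.norm_eq_abs]
    nlinarith [norm_nonneg (f x b.2.1)]

theorem good2 (hf : Good Λ1 f) (hg : Good Λ2 g) : Good (LS Λ1 Λ2) (hS2 C1 g) := by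
  refine ⟨LS_meas hf hg, ?_, fun R => ?_, ?_⟩
  · have : Continuous fun z : E × ℝ × C1 × C2 => g z.1 z.2.2.2 :=
      hg.cont.comp (f := fun z : E × ℝ × C1 × C2 => (z.1, z.2.2.2)) (by fun_prop)
    exact Continuous.smul (by fun_prop) this
  · obtain ⟨L, hL, h⟩ := hg.lip R
    refine ⟨L, hL, fun b hb x y hx hy => ?_⟩
    have h1 := h b.2.2 hb.2.2 x y hx hy
    have h2 := (nu_abs hb.1).2.1
    simp only [hS2]
    rw [← smul_sub, norm_smul, Real.norm_eq_abs]
    nlinarith [norm_nonneg (g x b.2.2 - g y b.2.2)]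
  · obtain ⟨L, hL, h⟩ := hg.grow
    refine ⟨L, hL, fun b hb x => ?_⟩
    have h1 := h b.2.2 hb.2.2 x
    have h2 := (nu_abs hb.1).2.1
    simp only [hS2]
    rw [norm_smul, Real.norm_eq_abs]
    nlinarith [norm_nonneg (g x b.2.2)]

theorem Good.add {h' : E → C → E} (hh : Good Λ h) (hh' : Good Λ h') :
    Good Λ (fun x c => h x c + h' x c) := by
  refine ⟨hh.mset, hh.cont.add hh'.cont, fun R => ?_, ?_⟩
  · obtain ⟨L, hL, h1⟩ := hh.lip R
    obtain ⟨L', hL', h1'⟩ := hh'.lip R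
    refine ⟨L + L', by positivity, fun b hb x y hx hy => ?_⟩
    rw [add_sub_add_comm, add_mul]
    exact (norm_add_le _ _).trans (add_le_add (h1 b hb x y hx hy) (h1' b hb x y hx hy))
  · obtain ⟨L, hL, h1⟩ := hh.grow
    obtain ⟨L', hL', h1'⟩ := hh'.grow
    refine ⟨L + L', by positivity, fun b hb x => ?_⟩
    rw [add_mul]
    exact (norm_add_le _ _).trans (add_le_add (h1 b hb x) (h1' b hb x))

abbrev hSt (f : E → C1 → E) (g : E → C2 → E) : E → ℝ × C1 × C2 → E :=
  fun x c => hS1 C2 f x c + hS2 C1 g x c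

theorem goodS (hf : Good Λ1 f) (hg : Good Λ2 g) : Good (LS Λ1 Λ2) (hSt f g) :=
  (good1 hf hg).add (good2 hf hg)

theorem flow1 (hH1 : Flow Λ1 f H1) :
    Flow (LS Λ1 Λ2) (hS1 C2 f) (fun c τ x => H1 c.2.1 (c.1 * τ) x) := by
  refine ⟨fun b hb x => by rw [mul_zero]; exact hH1.zero _ hb.2.1 x, fun b hb x τ => ?_⟩
  have h1 := hH1.deriv _ hb.2.1 x (b.1 * τ)
  have h2 : HasDerivAt (fun τ => b.1 * τ) b.1 τ := by
    simpa using (hasDerivAt_id τ).const_mul b.1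
  exact h1.scomp τ h2

theorem flow2 (hH2 : Flow Λ2 g H2) :
    Flow (LS Λ1 Λ2) (hS2 C1 g) (fun c τ x => H2 c.2.2 ((1 - c.1) * τ) x) := by
  refine ⟨fun b hb x => by rw [mul_zero]; exact hH2.zero _ hb.2.2 x, fun b hb x τ => ?_⟩
  have h1 := hH2.deriv _ hb.2.2 x ((1 - b.1) * τ)
  have h2 : HasDerivAt (fun τ => (1 - b.1) * τ) (1 - b.1) τ := by
    simpa using (hasDerivAt_id τ).const_mul (1 - b.1)
  exact h1.scomp τ h2

/-- Lemma B' -/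
theorem lemmaB (hf : Good Λ1 f) (hg : Good Λ2 g) (hH1 : Flow Λ1 f H1) (hH2 : Flow Λ2 g H2)
    (hcomm : ∀ b ∈ Λ1, ∀ b' ∈ Λ2, ∀ τ τ', 0 ≤ τ → 0 ≤ τ' → ∀ x,
      H1 b τ (H2 b' τ' x) = H2 b' τ' (H1 b τ x)) {a b : ℝ} (hab : a ≤ b) {y : ℝ → E}
    (hy : Tr (LS Λ1 Λ2) (hSt f g) a b y) :
    ∃ ξ ∈ Icc a b, ∃ z, Tr Λ1 f a ξ z ∧ z a = y a ∧
      (∀ t ∈ Icc a ξ, ∃ s ∈ Icc t b, ∃ w, Tr Λ2 g t s w ∧ w t = z t ∧ w s = y s) ∧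
      ∃ w, Tr Λ2 g ξ b w ∧ w ξ = z ξ ∧ w b = y b := by
  obtain ⟨μ, hμ, hm⟩ := hy
  have g1 := good1 hf hg
  have g2 := good2 hf hg
  have hc := hμ.ctl
  obtain ⟨X, hX⟩ := exists_flow g1 hc hab
  obtain ⟨w, hw, hwa⟩ := exists_mot g2 hc hab (y a)
  have hcomm' : ∀ b ∈ LS Λ1 Λ2, ∀ b' ∈ LS Λ1 Λ2, ∀ τ τ', 0 ≤ τ → 0 ≤ τ' → ∀ x,
      H1 b.2.1 (b.1 * τ) (H2 b'.2.2 ((1 - b'.1) * τ') x) =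
        H2 b'.2.2 ((1 - b'.1) * τ') (H1 b.2.1 (b.1 * τ) x) := by
    intro b hb b' hb' τ τ' hτ hτ' x
    exact hcomm _ hb.2.1 _ hb'.2.2 _ _ (mul_nonneg (nu_abs hb.1).2.2.1 hτ)
      (mul_nonneg (nu_abs hb'.1).2.2.2 hτ') x
  have hdiag := diagonal g1 g2 (g1.add g2) (flow1 hH1) (flow2 hH2) hcomm' hc hab hX hw hm hwa
  set K : Set (ℝ × C1 × C2) := {c | c.1 = 1} with hKdef
  have hK : MeasurableSet K := measurableSet_eq_fun measurable_fst measurable_const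
  have hK' : MeasurableSet (Prod.snd ⁻¹' K : Set (ℝ × ℝ × C1 × C2)) := measurable_snd hK
  have hnu : ∀ c ∈ LS Λ1 Λ2, c ∉ K → c.1 = 0 := by
    intro c hc hcK
    rcases hc.1 with h | h
    · exact h
    · exact absurd h hcK
  -- masses
  set β1 := fun s => μ.real (strip (ℝ × C1 × C2) a s ∩ Prod.snd ⁻¹' K) with hβ1
  set β2 := fun s => μ.real (strip (ℝ × C1 × C2) a s ∩ Prod.snd ⁻¹' Kᶜ) with hβ2
  have hsum : ∀ s ∈ Icc a b, a + β1 s + β2 s = s := by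
    intro s hs
    have h1 : μ.real (strip (ℝ × C1 × C2) a s) = s - a := by
      rw [measureReal_def, strip, ← Measure.map_apply measurable_fst measurableSet_Ioc, hμ.1,
        Measure.restrict_apply measurableSet_Ioc, inter_eq_left.2 (Ioc_subset_Ioc_right hs.2),
        Real.volume_Ioc, ENNReal.toReal_ofReal (by linarith [hs.1])]
    have h2 := measureReal_inter_add_sdiff (μ := μ) (s := strip (ℝ × C1 × C2) a s) hK'
      (hc.strip_lt _ _).ne
    have h3 : strip (ℝ × C1 × C2) a s \ Prod.snd ⁻¹' K =
      strip (ℝ × C1 × C2) a s ∩ Prod.snd ⁻¹' Kᶜ := by rw [preimage_compl, sdiff_eq]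
    rw [h3] at h2
    simp only [hβ1, hβ2]
    linarith
  have hβ1n : ∀ s, 0 ≤ β1 s := fun s => measureReal_nonneg
  have hβ2n : ∀ s, 0 ≤ β2 s := fun s => measureReal_nonneg
  have haI : a ∈ Icc a b := ⟨le_rfl, hab⟩
  have hbI : b ∈ Icc a b := ⟨hab, le_rfl⟩
  -- continuity of β1
  have hlam : Ctl (LS Λ1 Λ2) (μ.restrict (Prod.snd ⁻¹' K)) :=
    ⟨(Measure.map_mono Measure.restrict_le_self measurable_fst).trans hc.1,
      ae_restrict_of_ae hc.2⟩
  obtain ⟨hθc, -, hθa, hθv⟩ := mass_props hlam hab a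
  have hθv' : ∀ r ∈ Icc a b, a + (μ.restrict (Prod.snd ⁻¹' K)).real
      (strip (ℝ × C1 × C2) a (max a (min b r))) = a + β1 r := by
    intro r hr
    refine (hθv r hr).trans ?_
    rw [measureReal_restrict_apply (measurableSet_strip _ _)]
  obtain ⟨z, hz, hzv⟩ := select hf g1 hc hK (π := fun c => c.2.1) (by fun_prop)
    (fun c hc => hc.2.1) (fun c hc hcK x => by
      have : c.1 = 1 := hcK
      simp [hS1, this]) (fun c hc hcK x => by simp [hS1, hnu c hc hcK]) hab (hX (y a)).1 a
  have hws : ∀ s ∈ Icc a b, ∃ w', Tr Λ2 g (a + β1 s) s w' ∧ w' (a + β1 s) = z (a + β1 s) ∧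
      w' s = y s := by
    intro s hs
    have hM2 := two_param g1 g2 (flow1 hH1) (flow2 hH2) hcomm' hc hab hX hc hw hs
    obtain ⟨w', hw', hwv'⟩ := select hg g2 hc hK.compl (π := fun c => c.2.2) (by fun_prop)
      (fun c hc => hc.2.2) (fun c hc hcK x => by
        simp [hS2, hnu c hc hcK]) (fun c hc hcK x => by
        have : c.1 = 1 := not_not.1 hcK
        simp [hS2, this]) hs.1 (hM2.mono le_rfl hs.2) (a + β1 s)
    have e := hsum s hs
    have hwT : Tr Λ2 g (a + β1 s) s w' := by
      have hw2 : Tr Λ2 g (a + β1 s) (a + β1 s + β2 s) w' := hw'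
      rwa [e] at hw2
    refine ⟨w', hwT, ?_, ?_⟩
    · have h1 := hwv' a ⟨le_rfl, hs.1⟩
      have h2 : strip (ℝ × C1 × C2) a a = ∅ := by simp [strip]
      rw [h2, empty_inter, measureReal_empty, add_zero] at h1
      rw [h1, hwa]
      exact (hzv s hs).symm
    · have h1 := hwv' s ⟨hs.1, le_rfl⟩
      rw [hdiag s hs, ← h1]
      congr 1
      exact e.symm
  refine ⟨a + β1 b, ⟨by linarith [hβ1n b], by linarith [hsum b hbI, hβ2n b]⟩, z, hz, ?_, ?_,
    hws b hbI⟩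
  · have h1 := hzv a haI
    have h2 : strip (ℝ × C1 × C2) a a = ∅ := by simp [strip]
    rw [h2, empty_inter, measureReal_empty, add_zero] at h1
    rw [h1, (hX _).2]
  · intro t ht
    have hivt := intermediate_value_Icc hab hθc.continuousOn
    beta_reduce at hθa
    obtain ⟨s, hs, hst⟩ := hivt (show t ∈ Icc _ _ by
      rw [hθa, hθv' b hbI]; exact ht)
    beta_reduce at hst
    rw [hθv' s hs] at hst
    refine ⟨s, ⟨by linarith [hsum s hs, hβ2n s], hs.2⟩, ?_⟩
    obtain ⟨w', h1, h2, h3⟩ := hws s hs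
    rw [hst] at h1 h2
    exact ⟨w', h1, h2, h3⟩

end star
end Slide

namespace Slide
set_option linter.unusedSectionVars false
open Set Filter Topology

variable {E : Type*} [NormedAddCommGroup E] [NormedSpace ℝ E] [ProperSpace E]
variable {C : Type*} [TopologicalSpace C] [MeasurableSpace C] [BorelSpace C]
  [SecondCountableTopology C]
variable {Λ : Set C} {μ : Measure (ℝ × C)} {h : E → C → E}

theorem good_of (hΛ : MeasurableSet Λ) (hc : Continuous fun z : E × C => h z.1 z.2)
    (hl : ∀ x₀ : E, ∃ ε > (0 : ℝ), ∃ L : NNReal,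
      ∀ u ∈ Λ, LipschitzOnWith L (fun x => h x u) (Metric.ball x₀ ε))
    (hg : ∃ c > (0 : ℝ), ∀ x, ∀ u ∈ Λ, ‖h x u‖ ≤ c * (1 + ‖x‖)) : Good Λ h := by
  obtain ⟨c, hc0, hg⟩ := hg
  refine ⟨hΛ, hc, fun R => ?_, c, hc0.le, fun b hb x => hg x b hb⟩
  choose ε hε L hL using hl
  obtain ⟨t, -, ht⟩ := (isCompact_closedBall (0 : E) R).elim_nhds_subcover
    (fun x => Metric.ball x (ε x)) (fun x _ => Metric.ball_mem_nhds x (hε x))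
  obtain ⟨δ, hδ, hδ'⟩ := lebesgue_number_lemma_of_metric (isCompact_closedBall (0 : E) R)
    (c := fun i : t => Metric.ball (i : E) (ε i)) (fun _ => Metric.isOpen_ball) (by
      intro x hx
      obtain ⟨i, hi, hxi⟩ := mem_iUnion₂.1 (ht hx)
      exact mem_iUnion.2 ⟨⟨i, hi⟩, hxi⟩)
  set L0 : ℝ := ∑ i ∈ t, (L i : ℝ) with hL0
  have hL0n : 0 ≤ L0 := Finset.sum_nonneg fun i _ => (L i).2
  have hLi : ∀ i ∈ t, (L i : ℝ) ≤ L0 := fun i hi =>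
    Finset.single_le_sum (f := fun i => (L i : ℝ)) (fun i _ => (L i).2) hi
  set B := 2 * (c * (1 + |R|)) / δ with hB
  have hB0 : 0 ≤ B := by positivity
  refine ⟨L0 + B, by positivity, fun b hb x y hx hy => ?_⟩
  rcases lt_or_ge ‖x - y‖ δ with hd | hd
  · obtain ⟨i, hi⟩ := hδ' x (by simpa using hx)
    have h1 := (hL i b hb).dist_le_mul x (hi (Metric.mem_ball_self hδ)) y
      (hi (by rw [Metric.mem_ball, dist_comm, dist_eq_norm]; exact hd))
    rw [dist_eq_norm, dist_eq_norm] at h1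
    refine h1.trans ?_
    gcongr
    linarith [hLi i i.2]
  · have h1 := hg x b hb
    have h2 := hg y b hb
    have hR := le_abs_self R
    have h3 : ‖h x b - h y b‖ ≤ 2 * (c * (1 + |R|)) := by
      have := norm_sub_le (h x b) (h y b)
      have h4 : c * (1 + ‖x‖) ≤ c * (1 + |R|) := by gcongr; linarith
      have h5 : c * (1 + ‖y‖) ≤ c * (1 + |R|) := by gcongr; linarith
      linarith
    have h4 : B * δ = 2 * (c * (1 + |R|)) := by rw [hB]; field_simp
    have h5 : B * δ ≤ B * ‖x - y‖ := by gcongr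
    have h6 : 0 ≤ L0 * ‖x - y‖ := by positivity
    linarith

theorem FC.of_slide {ϑ : ℝ} (hμ : IsSlideControl ϑ Λ μ) : FC Λ 0 ϑ μ := by
  refine ⟨hμ.1.trans (Measure.restrict_congr_set Ioc_ae_eq_Icc).symm, ?_⟩
  have h2 : ∀ᵐ z ∂μ, z ∈ Icc 0 ϑ ×ˢ Λ := by
    rw [ae_iff]; exact hμ.2
  filter_upwards [h2] with z hz using hz.2

theorem FC.to_slide {ϑ : ℝ} (hμ : FC Λ 0 ϑ μ) : IsSlideControl ϑ Λ μ := by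
  have h1 : μ.map Prod.fst = volume.restrict (Icc 0 ϑ) :=
    hμ.1.trans (Measure.restrict_congr_set Ioc_ae_eq_Icc)
  refine ⟨h1, ?_⟩
  have h2 : ∀ᵐ z ∂μ, z.1 ∈ Icc 0 ϑ := by
    have : ∀ᵐ r ∂(μ.map Prod.fst), r ∈ Icc 0 ϑ := by
      rw [h1]; exact ae_restrict_mem measurableSet_Icc
    exact ae_of_ae_map measurable_fst.aemeasurable this
  have h3 : ∀ᵐ z ∂μ, z ∈ Icc 0 ϑ ×ˢ Λ := by
    filter_upwards [h2, hμ.2] with z hz hz' using ⟨hz, hz'⟩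
  exact ae_iff.1 h3

theorem strip_ae {a b : ℝ} (hμ : FC Λ a b μ) (s t : ℝ) :
    (Icc s t ×ˢ Λ : Set (ℝ × C)) =ᵐ[μ] strip C s t := by
  have h1 : ∀ᵐ z ∂μ, z.1 ≠ s := by
    have : ∀ᵐ r ∂(μ.map Prod.fst), r ≠ s := by
      rw [hμ.1]
      exact ae_restrict_of_ae (Measure.ae_ne volume s)
    exact ae_of_ae_map measurable_fst.aemeasurable this
  filter_upwards [h1, hμ.2] with z hz hz'
  apply propext
  constructor
  · rintro ⟨h, -⟩
    exact ⟨lt_of_le_of_ne h.1 (Ne.symm hz), h.2⟩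
  · rintro h
    exact ⟨⟨h.1.le, h.2⟩, hz'⟩

section motion
variable {n : ℕ} {k : EuclideanSpace ℝ (Fin n) → C → EuclideanSpace ℝ (Fin n)}

theorem mot_to (hh : Good Λ k) {ϑ t0 : ℝ} (ht0 : t0 ∈ Icc 0 ϑ) {x0 : EuclideanSpace ℝ (Fin n)}
    {x : ℝ → EuclideanSpace ℝ (Fin n)} (hμ : IsSlideControl ϑ Λ μ)
    (hx : IsMotion ϑ Λ k μ t0 x0 x) :
    ∃ x', Tr Λ k 0 ϑ x' ∧ ∀ t ∈ Icc 0 ϑ, x' t = x t := by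
  have hF := FC.of_slide hμ
  have hϑ : 0 ≤ ϑ := ht0.1.trans ht0.2
  set x' := fun t => x (max 0 (min ϑ t)) with hx'
  have hcl : ∀ t ∈ Icc 0 ϑ, x' t = x t := fun t ht => by
    simp only [hx']; rw [min_eq_right ht.2, max_eq_right ht.1]
  have hx'c : Continuous x' := hx.1.comp_continuous (by fun_prop) fun t =>
    ⟨le_max_left _ _, max_le hϑ (min_le_left _ _)⟩
  have hIntg : ∀ s ∈ Icc 0 ϑ, ∀ t ∈ Icc 0 ϑ, ∫ z in Icc s t ×ˢ Λ, k (x z.1) z.2 ∂μ =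
      ∫ z in strip C s t, k (x' z.1) z.2 ∂μ := by
    intro s hs t ht
    rw [setIntegral_congr_set (strip_ae hF s t)]
    refine setIntegral_congr_fun (measurableSet_strip _ _) fun z hz => ?_
    have hz : z.1 ∈ Ioc s t := hz
    simp only [hcl z.1 ⟨hs.1.trans hz.1.le, hz.2.trans ht.2⟩]
  refine ⟨x', ⟨μ, hF, ?_⟩, hcl⟩
  refine Mot.join hh hF.ctl (c := t0) ?_ ?_
  · refine ⟨hx'c, fun s t h1 h2 h3 => ?_⟩
    have hs : s ∈ Icc 0 ϑ := ⟨h1, (h2.trans h3).trans ht0.2⟩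
    have ht : t ∈ Icc 0 ϑ := ⟨h1.trans h2, h3.trans ht0.2⟩
    rw [hcl s hs, hcl t ht, hx.2.2.2 s hs (h2.trans h3), hx.2.2.2 t ht h3, hIntg s hs t0 ht0,
      hIntg t ht t0 ht0, int_add h2 h3 (hh.integrableOn hF.ctl hx'c s t0)]
    abel
  · refine Mot.of_base hh hF.ctl (x0 := x0) hx'c fun t ht => ?_
    have ht' : t ∈ Icc 0 ϑ := ⟨ht0.1.trans ht.1, ht.2⟩
    rw [hcl t ht', hx.2.2.1 t ht' ht.1, hIntg t0 ht0 t ht']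

theorem Tr.extend (hh : Good Λ k) {H : C → ℝ → EuclideanSpace ℝ (Fin n) → EuclideanSpace ℝ (Fin n)}
    (hH : Flow Λ k H) (hne : Λ.Nonempty) {ϑ a b : ℝ} (ha : 0 ≤ a) (hab : a ≤ b) (hb : b ≤ ϑ)
    {x : ℝ → EuclideanSpace ℝ (Fin n)} (hx : Tr Λ k a b x) :
    ∃ x', Tr Λ k 0 ϑ x' ∧ ∀ t ∈ Icc a b, x' t = x t := by
  obtain ⟨c, hc⟩ := hne
  have h1 := hH.tr hh hc a (x a) 0 a
  have h2 := hH.tr hh hc b (x b) b ϑ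
  have e1 : (fun t => H c (t - a) (x a)) a = x a := by simp [hH.zero c hc]
  have h3 := Tr.concat hh ha hab h1 hx e1
  have e2 : glue (fun t => H c (t - a) (x a)) x a b = (fun t => H c (t - b) (x b)) b := by
    rw [glue_right hab]; simp [hH.zero c hc]
  have h4 := Tr.concat hh (ha.trans hab) hb h3 h2 e2
  refine ⟨_, h4, fun t ht => ?_⟩
  rw [glue_left e2 ht.2, glue_right ht.1]

theorem mot_of (hh : Good Λ k) {H : C → ℝ → EuclideanSpace ℝ (Fin n) → EuclideanSpace ℝ (Fin n)}
    (hH : Flow Λ k H) (hne : Λ.Nonempty) {ϑ a b : ℝ} (ha : 0 ≤ a) (hab : a ≤ b) (hb : b ≤ ϑ)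
    {x : ℝ → EuclideanSpace ℝ (Fin n)} (hx : Tr Λ k a b x) {t0 : ℝ} (ht0 : t0 ∈ Icc a b) :
    ∃ μ, IsSlideControl ϑ Λ μ ∧ ∃ x', IsMotion ϑ Λ k μ t0 (x t0) x' ∧ ∀ t ∈ Icc a b, x' t = x t := by
  obtain ⟨x', ⟨μ, hF, hm⟩, he⟩ := hx.extend hh hH hne ha hab hb
  refine ⟨μ, hF.to_slide, x', ⟨hm.cont.continuousOn, he t0 ht0, fun t ht h => ?_,
    fun t ht h => ?_⟩, he⟩
  · rw [setIntegral_congr_set (strip_ae hF t0 t), ← he t0 ht0,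
      ← hm.inc t0 t (ha.trans ht0.1) h ht.2]
    abel
  · rw [setIntegral_congr_set (strip_ae hF t t0), ← he t0 ht0,
      ← hm.inc t t0 ht.1 h (ht0.2.trans hb)]
    abel

end motion
end Slide

namespace Slide
set_option linter.unusedSectionVars false
open Set Filter Topology

variable {E : Type*} [NormedAddCommGroup E] [NormedSpace ℝ E] [ProperSpace E]
variable {C : Type*} [TopologicalSpace C] [MeasurableSpace C] [BorelSpace C]
  [SecondCountableTopology C]
variable {Λ : Set C} {μ : Measure (ℝ × C)} {h : E → C → E}

section core
variable {C1 C2 V : Type*}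
  [TopologicalSpace C1] [MeasurableSpace C1] [BorelSpace C1] [SecondCountableTopology C1]
  [TopologicalSpace C2] [MeasurableSpace C2] [BorelSpace C2] [SecondCountableTopology C2]
  {P : Set C1} {Ω : Set C2} {Q : Set V} {f : V → E → C1 → E} {g : E → C2 → E}
  {H1 : V → C1 → ℝ → E → E} {H2 : C2 → ℝ → E → E} {ϑ : ℝ}

/-- trajectory form of the absorption operator -/
def opA (ϑ : ℝ) (P : Set C1) (Q : Set V) (f : V → E → C1 → E) (M W : Set (ℝ × E)) :
    Set (ℝ × E) :=
  {pt ∈ W | ∀ v ∈ Q, ∃ ξ ∈ Icc pt.1 ϑ, ∃ y, Tr P (f v) pt.1 ξ y ∧ y pt.1 = pt.2 ∧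
    (ξ, y ξ) ∈ M ∧ ∀ t ∈ Icc pt.1 ξ, (t, y t) ∈ W}

/-- trajectory form of the transformed absorption operator -/
def opS (ϑ : ℝ) (P : Set C1) (Ω : Set C2) (Q : Set V) (f : V → E → C1 → E) (g : E → C2 → E)
    (F : Set E) (W : Set (ℝ × E)) : Set (ℝ × E) :=
  {pt ∈ W | ∀ v ∈ Q, ∃ y, Tr (LS P Ω) (hSt (f v) g) pt.1 ϑ y ∧ y pt.1 = pt.2 ∧
    y ϑ ∈ F ∧ ∀ t ∈ Icc pt.1 ϑ, (t, y t) ∈ W}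

/-- trajectory form of the controllability set -/
def setM (ϑ : ℝ) (Ω : Set C2) (g : E → C2 → E) (F : Set E) : Set (ℝ × E) :=
  {pt | pt.1 ∈ Icc 0 ϑ ∧ ∃ w, Tr Ω g pt.1 ϑ w ∧ w pt.1 = pt.2 ∧ w ϑ ∈ F}

/-- trajectory form of decrease by sections -/
def DS (Ω : Set C2) (g : E → C2 → E) (W : Set (ℝ × E)) : Prop :=
  ∀ t s w, 0 ≤ t → t ≤ s → Tr Ω g t s w → (s, w s) ∈ W → (t, w t) ∈ W

theorem DS_M (hg : Good Ω g) {F : Set E} : DS Ω g (setM ϑ Ω g F) := by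
  intro t s w ht hts hw ⟨hs, w', hw', hw's, hF⟩
  refine ⟨⟨ht, hts.trans hs.2⟩, _, Tr.concat hg hts hs.2 hw hw' hw's.symm, ?_, ?_⟩
  · exact glue_left hw's.symm hts
  · rw [glue_right hs.2]; exact hF

theorem DS_A (hf : ∀ v ∈ Q, Good P (f v)) (hg : Good Ω g)
    (hH1 : ∀ v ∈ Q, Flow P (f v) (H1 v)) (hH2 : Flow Ω g H2)
    (hcomm : ∀ v ∈ Q, ∀ b ∈ P, ∀ b' ∈ Ω, ∀ τ τ', 0 ≤ τ → 0 ≤ τ' → ∀ x,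
      H1 v b τ (H2 b' τ' x) = H2 b' τ' (H1 v b τ x))
    {M W : Set (ℝ × E)} (hM : DS Ω g M) (hW : DS Ω g W) : DS Ω g (opA ϑ P Q f M W) := by
  intro t s w ht hts hw ⟨hsW, hA⟩
  refine ⟨hW t s w ht hts hw hsW, fun v hv => ?_⟩
  obtain ⟨ξ, hξ, y, hy, hys, hyM, hyW⟩ := hA v hv
  simp only at hξ hy hys hyW
  obtain ⟨z, hz, hzs, hzw⟩ := lemmaA (hf v hv) hg (hH1 v hv) hH2 (hcomm v hv) hξ.1 hy hw hys
  have hz' := hz.shift (hf v hv) (t - s)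
  rw [add_sub_cancel] at hz'
  have key : ∀ U : Set (ℝ × E), DS Ω g U → ∀ r ∈ Icc t (ξ + (t - s)),
      (r - (t - s), y (r - (t - s))) ∈ U → (r, z (r - (t - s))) ∈ U := by
    intro U hU r hr hyU
    obtain ⟨w', hw', h1, h2⟩ := hzw (r - (t - s)) ⟨by linarith [hr.1], by linarith [hr.2]⟩
    have h3 := hw'.shift hg (r - t)
    have := hU r (r - (t - s)) (fun u => w' (u - (r - t))) (ht.trans hr.1) (by linarith)
      (by convert h3 using 1 <;> ring)
      (by
        have e : r - (t - s) - (r - t) = s := by ring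
        simp only [e, h2]; exact hyU)
    have e : r - (r - t) = t := by ring
    simp only [e, h1] at this
    exact this
  have hle : t ≤ ξ + (t - s) := by linarith [hξ.1]
  refine ⟨ξ + (t - s), ⟨hle, by linarith [hξ.2]⟩, _, hz', ?_, ?_, ?_⟩
  · simp only
    rw [show t - (t - s) = s by ring, hzs]
  · refine key M hM _ ⟨hle, le_rfl⟩ ?_
    rw [add_sub_cancel_right]; exact hyM
  · intro r hr
    exact key W hW r hr (hyW _ ⟨by linarith [hr.1], by linarith [hr.2]⟩)

theorem opS_sub (hf : ∀ v ∈ Q, Good P (f v)) (hg : Good Ω g)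
    (hH1 : ∀ v ∈ Q, Flow P (f v) (H1 v)) (hH2 : Flow Ω g H2)
    (hcomm : ∀ v ∈ Q, ∀ b ∈ P, ∀ b' ∈ Ω, ∀ τ τ', 0 ≤ τ → 0 ≤ τ' → ∀ x,
      H1 v b τ (H2 b' τ' x) = H2 b' τ' (H1 v b τ x))
    {F : Set E} {W W' : Set (ℝ × E)} (hW : DS Ω g W) (hWW : W' ⊆ W)
    (hW0 : W' ⊆ Icc 0 ϑ ×ˢ univ) :
    opS ϑ P Ω Q f g F W' ⊆ opA ϑ P Q f (setM ϑ Ω g F) W := by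
  rintro ⟨t0, x0⟩ ⟨hp, hA⟩
  have ht0 : t0 ∈ Icc 0 ϑ := (hW0 hp).1
  refine ⟨hWW hp, fun v hv => ?_⟩
  obtain ⟨y, hy, hy0, hyF, hyW⟩ := hA v hv
  simp only at hy hy0 hyW
  obtain ⟨ξ, hξ, z, hz, hz0, hzt, w, hw, hwξ, hwb⟩ :=
    lemmaB (hf v hv) hg (hH1 v hv) hH2 (hcomm v hv) ht0.2 hy
  refine ⟨ξ, hξ, z, hz, hz0.trans hy0, ⟨⟨ht0.1.trans hξ.1, hξ.2⟩, w, hw, hwξ, ?_⟩, ?_⟩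
  · rw [hwb]; exact hyF
  · intro t ht
    obtain ⟨s, hs, w', hw', h1, h2⟩ := hzt t ht
    have := hW t s w' (ht0.1.trans ht.1) hs.1 hw'
      (by rw [h2]; exact hWW (hyW s ⟨ht.1.trans hs.1, hs.2⟩))
    rwa [h1] at this

theorem M_sub_opS (hf : ∀ v ∈ Q, Good P (f v)) (hg : Good Ω g) (hP : P.Nonempty)
    {F : Set E} {W : Set (ℝ × E)} (hMW : setM ϑ Ω g F ⊆ W) :
    setM ϑ Ω g F ⊆ opS ϑ P Ω Q f g F W := by
  rintro ⟨t0, x0⟩ hp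
  refine ⟨hMW hp, fun v hv => ?_⟩
  obtain ⟨ht0, w, hw, hw0, hwF⟩ := hp
  obtain ⟨u0, hu0⟩ := hP
  refine ⟨w, hw.map (goodS (hf v hv) hg) (π := fun ω => ((0 : ℝ), u0, ω)) (by fun_prop)
    (fun c hc => ⟨by simp, hu0, hc⟩) (fun c _ x => by simp [hSt, hS1, hS2]), hw0, hwF, fun t ht => ?_⟩
  exact hMW ⟨⟨ht0.1.trans ht.1, ht.2⟩, w, hw.mono ht.1 le_rfl, rfl, hwF⟩

theorem opA_sub (hf : ∀ v ∈ Q, Good P (f v)) (hg : Good Ω g) (hP : P.Nonempty)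
    (hΩ : Ω.Nonempty)
    {F : Set E} {W W' : Set (ℝ × E)} (hWW : W ⊆ W') (hMW : setM ϑ Ω g F ⊆ W') :
    opA ϑ P Q f (setM ϑ Ω g F) W ⊆ opS ϑ P Ω Q f g F W' := by
  rintro ⟨t0, x0⟩ ⟨hp, hA⟩
  refine ⟨hWW hp, fun v hv => ?_⟩
  obtain ⟨ξ, hξ, y, hy, hy0, ⟨hξ', w, hw, hwξ, hwF⟩, hyW⟩ := hA v hv
  simp only at hξ hy hy0 hyW hw hwξ hξ'
  obtain ⟨u0, hu0⟩ := hP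
  obtain ⟨ω0, hω0⟩ := hΩ
  have hG := goodS (hf v hv) hg
  have h1 := hy.map hG (π := fun u => ((1 : ℝ), u, ω0)) (by fun_prop)
    (fun c hc => ⟨by simp, hc, hω0⟩) (fun c _ x => by simp [hSt, hS1, hS2])
  have h2 := hw.map hG (π := fun ω => ((0 : ℝ), u0, ω)) (by fun_prop)
    (fun c hc => ⟨by simp, hu0, hc⟩) (fun c _ x => by simp [hSt, hS1, hS2])
  refine ⟨_, Tr.concat hG hξ.1 hξ.2 h1 h2 hwξ.symm, ?_, ?_, ?_⟩
  · rw [glue_left hwξ.symm hξ.1]; exact hy0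
  · rw [glue_right hξ.2]; exact hwF
  · intro t ht
    rcases le_total t ξ with h | h
    · rw [glue_left hwξ.symm h]; exact hWW (hyW t ⟨ht.1, h⟩)
    · rw [glue_right h]
      exact hMW ⟨⟨hξ'.1.trans h, ht.2⟩, w, hw.mono h le_rfl, rfl, hwF⟩

theorem core_eq (hf : ∀ v ∈ Q, Good P (f v)) (hg : Good Ω g)
    (hH1 : ∀ v ∈ Q, Flow P (f v) (H1 v)) (hH2 : Flow Ω g H2)
    (hcomm : ∀ v ∈ Q, ∀ b ∈ P, ∀ b' ∈ Ω, ∀ τ τ', 0 ≤ τ → 0 ≤ τ' → ∀ x,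
      H1 v b τ (H2 b' τ' x) = H2 b' τ' (H1 v b τ x)) (hP : P.Nonempty) (hΩ : Ω.Nonempty)
    {F : Set E} {A S : Set (ℝ × E) → Set (ℝ × E)}
    (hA : ∀ W ⊆ Icc 0 ϑ ×ˢ univ, A W = opA ϑ P Q f (setM ϑ Ω g F) W)
    (hS : ∀ W ⊆ Icc 0 ϑ ×ˢ univ, S W = opS ϑ P Ω Q f g F W) (k : ℕ) :
    A^[k] (Icc 0 ϑ ×ˢ univ) = S^[k] (Icc 0 ϑ ×ˢ univ) := by
  suffices h : A^[k] (Icc 0 ϑ ×ˢ univ) = S^[k] (Icc 0 ϑ ×ˢ univ) ∧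
      A^[k] (Icc 0 ϑ ×ˢ univ) ⊆ Icc 0 ϑ ×ˢ univ ∧
      setM ϑ Ω g F ⊆ A^[k] (Icc 0 ϑ ×ˢ univ) ∧ DS Ω g (A^[k] (Icc 0 ϑ ×ˢ univ)) from h.1
  induction k with
  | zero =>
    refine ⟨rfl, subset_rfl, fun pt hpt => ⟨hpt.1, trivial⟩, ?_⟩
    intro t s w ht hts hw hs
    exact ⟨⟨ht, hts.trans hs.1.2⟩, trivial⟩
  | succ k ih =>
    obtain ⟨h1, h2, h3, h4⟩ := ih
    rw [Function.iterate_succ_apply', Function.iterate_succ_apply', ← h1, hA _ h2, hS _ h2]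
    set W := A^[k] (Icc 0 ϑ ×ˢ univ)
    have heq : opA ϑ P Q f (setM ϑ Ω g F) W = opS ϑ P Ω Q f g F W :=
      (opA_sub hf hg hP hΩ subset_rfl h3).antisymm
        (opS_sub hf hg hH1 hH2 hcomm h4 subset_rfl h2)
    refine ⟨heq, fun pt hpt => h2 hpt.1, ?_, DS_A hf hg hH1 hH2 hcomm (DS_M hg) h4⟩
    rw [heq]
    exact M_sub_opS hf hg hP h3

theorem flowS {f : E → C1 → E} {H1 : C1 → ℝ → E → E} (hH1 : Flow P f H1) (hH2 : Flow Ω g H2) :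
    Flow (LS P Ω) (hSt f g)
      (fun c τ x => if c.1 = 1 then H1 c.2.1 τ x else H2 c.2.2 τ x) := by
  constructor
  · rintro ⟨ν, u, ω⟩ ⟨-, hu, hω⟩ x
    simp only
    split_ifs
    · exact hH1.zero u hu x
    · exact hH2.zero ω hω x
  · rintro ⟨ν, u, ω⟩ ⟨hν, hu, hω⟩ x τ
    rcases hν with hν | hν
    · simp only at hν
      subst hν
      simpa [hSt, hS1, hS2] using hH2.deriv ω hω x τ
    · simp only [mem_singleton_iff] at hν
      subst hν
      simpa [hSt, hS1, hS2] using hH1.deriv u hu x τ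

end core

end Slide

/-- statement 2 of the paper's Theorem: under the commutation hypothesis,
the solvability sets of the original `M`-approach game and of the transformed
`M*`-approach game, given by Chentsov's Programmed Iteration representation
`𝔚 = ⋂_k W_k`, coincide: `⋂_k W_k = ⋂_k W*_k`. -/
theorem solvability_sets_coincide
        {n p q m : ℕ} (ϑ : ℝ) (hϑ : 0 < ϑ)
    (P : Set (EuclideanSpace ℝ (Fin p))) (Q : Set (EuclideanSpace ℝ (Fin q)))
    (Ω : Set (EuclideanSpace ℝ (Fin m)))
    (hPne : P.Nonempty) (hPc : IsCompact P)
    (hQne : Q.Nonempty) (hQc : IsCompact Q)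
    (hΩne : Ω.Nonempty) (hΩc : IsCompact Ω)
    (f : EuclideanSpace ℝ (Fin n) → EuclideanSpace ℝ (Fin p) → EuclideanSpace ℝ (Fin q) →
      EuclideanSpace ℝ (Fin n))
    (g : EuclideanSpace ℝ (Fin n) → EuclideanSpace ℝ (Fin m) → EuclideanSpace ℝ (Fin n))
    (hf : Continuous fun z : EuclideanSpace ℝ (Fin n) × EuclideanSpace ℝ (Fin p) ×
      EuclideanSpace ℝ (Fin q) => f z.1 z.2.1 z.2.2)
    (hg : Continuous fun z : EuclideanSpace ℝ (Fin n) × EuclideanSpace ℝ (Fin m) => g z.1 z.2)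
    (hfLip : ∀ x₀ : EuclideanSpace ℝ (Fin n), ∃ ε > (0 : ℝ), ∃ L : NNReal,
      ∀ u ∈ P, ∀ v ∈ Q, LipschitzOnWith L (fun x => f x u v) (Metric.ball x₀ ε))
    (hgLip : ∀ x₀ : EuclideanSpace ℝ (Fin n), ∃ ε > (0 : ℝ), ∃ L : NNReal,
      ∀ ω ∈ Ω, LipschitzOnWith L (fun x => g x ω) (Metric.ball x₀ ε))
    (hfGrow : ∃ c > (0 : ℝ), ∀ x, ∀ u ∈ P, ∀ v ∈ Q, ‖f x u v‖ ≤ c * (1 + ‖x‖))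
    (hgGrow : ∃ c > (0 : ℝ), ∀ x, ∀ ω ∈ Ω, ‖g x ω‖ ≤ c * (1 + ‖x‖))
    (M : Set (ℝ × EuclideanSpace ℝ (Fin n))) (hMcl : IsClosed M)
    (F : Set (EuclideanSpace ℝ (Fin n))) (hF : F = {x | (ϑ, x) ∈ M})
    -- `M` is the controllability set of `ẋ = g(x,ω)`, `ω ∈ Ω`, with target `{ϑ} × F`:
    (hM : M = {px : ℝ × EuclideanSpace ℝ (Fin n) | px.1 ∈ Set.Icc 0 ϑ ∧
      ∃ xF ∈ F, ∃ σ : Measure (ℝ × EuclideanSpace ℝ (Fin m)), IsSlideControl ϑ Ω σ ∧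
        ∃ y : ℝ → EuclideanSpace ℝ (Fin n), IsMotion ϑ Ω g σ ϑ xF y ∧ y px.1 = px.2})
    -- `𝓕` is the flow of the constant-control systems `ẋ = f(x,u,v)`:
    (𝓕 : EuclideanSpace ℝ (Fin p) → EuclideanSpace ℝ (Fin q) → ℝ →
      EuclideanSpace ℝ (Fin n) → EuclideanSpace ℝ (Fin n))
    (h𝓕₀ : ∀ u v x₀, 𝓕 u v 0 x₀ = x₀)
    (h𝓕 : ∀ u v x₀ τ, HasDerivAt (fun τ' => 𝓕 u v τ' x₀) (f (𝓕 u v τ x₀) u v) τ)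
    -- `𝓖` is the flow of the constant-control systems `ẋ = g(x,ω)`:
    (𝓖 : EuclideanSpace ℝ (Fin m) → ℝ →
      EuclideanSpace ℝ (Fin n) → EuclideanSpace ℝ (Fin n))
    (h𝓖₀ : ∀ ω x₀, 𝓖 ω 0 x₀ = x₀)
    (h𝓖 : ∀ ω x₀ τ, HasDerivAt (fun τ' => 𝓖 ω τ' x₀) (g (𝓖 ω τ x₀) ω) τ)
    -- the commutation hypothesis:
    (hcomm : ∀ u ∈ P, ∀ v ∈ Q, ∀ ω ∈ Ω, ∀ τ' τ'' : ℝ, 0 ≤ τ' → 0 ≤ τ'' →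
      (𝓕 u v τ') ∘ (𝓖 ω τ'') = (𝓖 ω τ'') ∘ (𝓕 u v τ')):
    (⋂ k : ℕ, (fun E => progAbsorb ϑ P Q f M E)^[k]
        (Set.Icc 0 ϑ ×ˢ (Set.univ : Set (EuclideanSpace ℝ (Fin n))))) =
      ⋂ k : ℕ, (fun E => progAbsorbStar ϑ P Q Ω f g F E)^[k]
        (Set.Icc 0 ϑ ×ˢ (Set.univ : Set (EuclideanSpace ℝ (Fin n)))) := by
  have hgG : Slide.Good Ω g := Slide.good_of hΩc.measurableSet hg hgLip hgGrow
  have hfG : ∀ v ∈ Q, Slide.Good P (fun x u => f x u v) := by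
    intro v hv
    refine Slide.good_of hPc.measurableSet ?_ ?_ ?_
    · exact hf.comp (f := fun z : EuclideanSpace ℝ (Fin n) × EuclideanSpace ℝ (Fin p) =>
        (z.1, z.2, v)) (by fun_prop)
    · intro x₀
      obtain ⟨ε, hε, L, hL⟩ := hfLip x₀
      exact ⟨ε, hε, L, fun u hu => hL u hu v hv⟩
    · obtain ⟨c, hc, h⟩ := hfGrow
      exact ⟨c, hc, fun x u hu => h x u hu v hv⟩
  have hH2 : Slide.Flow Ω g 𝓖 := ⟨fun b _ x => h𝓖₀ b x, fun b _ x τ => h𝓖 b x τ⟩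
  have hH1 : ∀ v ∈ Q, Slide.Flow P (fun x u => f x u v) (fun u => 𝓕 u v) :=
    fun v _ => ⟨fun b _ x => h𝓕₀ b v x, fun b _ x τ => h𝓕 b v x τ⟩
  have hMeq : M = Slide.setM ϑ Ω g F := by
    rw [hM]
    ext ⟨t, x⟩
    constructor
    · rintro ⟨ht, xF, hxF, σ, hσ, y, hy, hyx⟩
      obtain ⟨x', hx', he⟩ := Slide.mot_to hgG (Set.right_mem_Icc.2 hϑ.le) hσ hy
      refine ⟨ht, x', hx'.mono ht.1 le_rfl, (he t ht).trans hyx, ?_⟩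
      rw [he ϑ (Set.right_mem_Icc.2 hϑ.le), hy.2.1]
      exact hxF
    · rintro ⟨ht, w, hw, hwt, hwF⟩
      obtain ⟨σ, hσ, y, hy, he⟩ := Slide.mot_of hgG hH2 hΩne ht.1 ht.2 le_rfl hw
        (Set.right_mem_Icc.2 ht.2)
      exact ⟨ht, w ϑ, hwF, σ, hσ, y, hy, (he t (Set.left_mem_Icc.2 ht.2)).trans hwt⟩
  refine Set.iInter_congr fun k => ?_
  refine Slide.core_eq (f := fun v x u => f x u v) (H1 := fun v u => 𝓕 u v) (P := P) (Ω := Ω)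
    (Q := Q) (F := F) hfG hgG hH1 hH2 ?_ hPne hΩne ?_ ?_ k
  · intro v hv b hb b' hb' τ τ' hτ hτ' x
    exact congrFun (hcomm b hb v hv b' hb' τ τ' hτ hτ') x
  · intro W hW
    rw [← hMeq]
    ext ⟨t, x⟩
    refine and_congr_right fun hp => forall₂_congr fun v hv => ?_
    have ht : t ∈ Set.Icc 0 ϑ := (hW hp).1
    constructor
    · rintro ⟨μ, hμ, ξ, hξ, y, hy, hyM, hyW⟩
      obtain ⟨x', hx', he⟩ := Slide.mot_to (hfG v hv) ht hμ hy
      refine ⟨ξ, hξ, x', hx'.mono ht.1 hξ.2, (he t ht).trans hy.2.1, ?_, fun s hs => ?_⟩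
      · rw [he ξ ⟨ht.1.trans hξ.1, hξ.2⟩]; exact hyM
      · rw [he s ⟨ht.1.trans hs.1, hs.2.trans hξ.2⟩]; exact hyW s hs
    · rintro ⟨ξ, hξ, y, hy, hyx, hyM, hyW⟩
      obtain ⟨μ, hμ, x', hx', he⟩ := Slide.mot_of (hfG v hv) (hH1 v hv) hPne ht.1 hξ.1 hξ.2 hy
        (Set.left_mem_Icc.2 hξ.1)
      simp only at hyx
      rw [hyx] at hx'
      refine ⟨μ, hμ, ξ, hξ, x', hx', ?_, fun s hs => ?_⟩
      · rw [he ξ (Set.right_mem_Icc.2 hξ.1)]; exact hyM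
      · rw [he s hs]; exact hyW s hs
  · intro W hW
    ext ⟨t, x⟩
    refine and_congr_right fun hp => forall₂_congr fun v hv => ?_
    have ht : t ∈ Set.Icc 0 ϑ := (hW hp).1
    have hϑm := Set.right_mem_Icc.2 ht.2
    have hG := Slide.goodS (hfG v hv) hgG
    have hne : (Slide.LS P Ω).Nonempty :=
      ⟨(1, hPne.some, hΩne.some), by simp, hPne.some_mem, hΩne.some_mem⟩
    constructor
    · rintro ⟨μ, hμ, y, hy, hyF, hyW⟩
      obtain ⟨x', hx', he⟩ := Slide.mot_to hG ht hμ hy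
      refine ⟨x', hx'.mono ht.1 le_rfl, (he t ht).trans hy.2.1, ?_, fun s hs => ?_⟩
      · rw [he ϑ (Set.right_mem_Icc.2 hϑ.le)]; exact hyF
      · rw [he s ⟨ht.1.trans hs.1, hs.2⟩]; exact hyW s hs
    · rintro ⟨y, hy, hyx, hyF, hyW⟩
      obtain ⟨μ, hμ, x', hx', he⟩ := Slide.mot_of hG (Slide.flowS (hH1 v hv) hH2) hne ht.1 ht.2
        le_rfl hy (Set.left_mem_Icc.2 ht.2)
      simp only at hyx
      rw [hyx] at hx'
      refine ⟨μ, hμ, x', hx', ?_, fun s hs => ?_⟩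
      · rw [he ϑ hϑm]; exact hyF
      · rw [he s hs]; exact hyW s hs
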